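/- arXiv:2508.00601 — 2 statements merged into one kernel-verified Lean document; each statement's English description precedes it below -/
import Mathlib

section
/- The measure μ_p is doubling on [0,1] if and only if there exist constants C₁, C₂ > 0 such that for every n ≥ 2 and every j with 0 ≤ j ≤ #X_n − 4, one has C₁ ≤ (W_n(a_{n,j}) + W_n(a_{n,j+1})) / (W_n(a_{n,j+1}) + W_n(a_{n,j+2})) ≤ C₂. -/
open MeasureTheory

noncomputable section

/-- The contraction maps: `Smap β 0 = S₁ : x ↦ x/β` and `Smap β 1 = S₂ : x ↦ x/β + (1 - 1/β)`. -/
def Smap (β : ℝ) (i : Fin 2) (x : ℝ) : ℝ :=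
  if i = 0 then x / β else x / β + (1 - 1 / β)

/-- `Sapply β I = S_I = S_{i₁} ∘ ⋯ ∘ S_{i_n}` for a word `I = i₁…i_n ∈ {1,2}^n`. -/
def Sapply (β : ℝ) : {n : ℕ} → (Fin n → Fin 2) → ℝ → ℝ
  | 0, _, x => x
  | _+1, I, x => Smap β (I 0) (Sapply β (fun k => I k.succ) x)

/-- `Xn β n = {S_I(0) : I ∈ {1,2}^n} ∪ {1}`. -/
def Xn (β : ℝ) (n : ℕ) : Finset ℝ :=
  (Finset.univ.image fun I : Fin n → Fin 2 => Sapply β I 0) ∪ {1}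

/-- `pt β n j = a_{n,j}`, the `j`-th element of `Xn β n` in increasing order
(junk value `0` if `j` is out of range). -/
def pt (β : ℝ) (n j : ℕ) : ℝ := ((Xn β n).sort (· ≤ ·)).getD j 0

/-- The sequence `d₀ = 1`, `d₁ = β - 1`, `d_{j+1} = β·d_j - d₁`. -/
def dd (β : ℝ) : ℕ → ℝ
  | 0 => 1
  | 1 => β - 1
  | j+2 => β * dd β (j+1) - (β - 1)

/-- The weight of a letter: `pw p₁ p₂ i = p_{i+1}`. -/
def pw (p1 p2 : ℝ) (i : Fin 2) : ℝ := if i = 0 then p1 else p2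

/-- `Wn β p₁ p₂ n x = W_n(x) = ∑_{S_I(0)=x, |I|=n} p_I`. -/
def Wn (β p1 p2 : ℝ) (n : ℕ) (x : ℝ) : ℝ :=
  ∑ I : Fin n → Fin 2, if Sapply β I 0 = x then ∏ k, pw p1 p2 (I k) else 0

/-- A measure with support `[0,1]` is doubling if
`sup { μ(B(x,2r))/μ(B(x,r)) : x ∈ supp μ = [0,1], r > 0 } < ∞`. -/
def IsDoubling (μ : Measure ℝ) : Prop :=
  (⨆ (x : ℝ) (_ : x ∈ Set.Icc (0:ℝ) 1) (r : ℝ) (_ : 0 < r),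
    μ (Metric.closedBall x (2 * r)) / μ (Metric.closedBall x r)) < ⊤

/-- digit value -/
def eps (i : Fin 2) : ℝ := if i = 0 then 0 else 1

lemma Smap_eq (β : ℝ) (i : Fin 2) (x : ℝ) : Smap β i x = x / β + eps i * (1 - 1 / β) := by
  unfold Smap eps; split_ifs <;> ring

lemma Sapply_eq (β : ℝ) (hβ : 1 < β) : ∀ (n : ℕ) (I : Fin n → Fin 2) (x : ℝ),
    Sapply β I x = x / β ^ n + ∑ k : Fin n, eps (I k) * (β - 1) / β ^ ((k : ℕ) + 1)
  | 0, I, x => by simp [Sapply]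
  | n+1, I, x => by
    have hb : β ≠ 0 := by positivity
    rw [Sapply, Smap_eq, Sapply_eq β hβ n, Fin.sum_univ_succ, add_div, Finset.sum_div]
    simp only [Fin.val_zero, Fin.val_succ]
    have : ∀ k : Fin n, eps (I k.succ) * (β - 1) / β ^ ((k : ℕ) + 1) / β
        = eps (I k.succ) * (β - 1) / β ^ ((k : ℕ) + 1 + 1) := by
      intro k; rw [div_div, ← pow_succ]
    simp only [this]
    rw [div_div, ← pow_succ]
    have : eps (I 0) * (1 - 1 / β) = eps (I 0) * (β - 1) / β ^ (0 + 1) := by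
      field_simp
      simp
      ring
    rw [this]; ring

lemma Sapply_affine (β : ℝ) (hβ : 1 < β) (n : ℕ) (I : Fin n → Fin 2) (x : ℝ) :
    Sapply β I x = Sapply β I 0 + x / β ^ n := by
  rw [Sapply_eq β hβ n I x, Sapply_eq β hβ n I 0]; simp; ring

/-- `x` is a level-`n` point -/
def PP (β : ℝ) (n : ℕ) (x : ℝ) : Prop := ∃ I : Fin n → Fin 2, Sapply β I 0 = x

lemma eps_cases (i : Fin 2) : eps i = 0 ∨ eps i = 1 := by
  unfold eps; split_ifs <;> simp

lemma PP_zero (β x : ℝ) : PP β 0 x ↔ x = 0 := by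
  unfold PP; simp [Sapply, eq_comm]

lemma PP_succ (β : ℝ) (hβ : 1 < β) (n : ℕ) (x : ℝ) :
    PP β (n+1) x ↔ ∃ y, PP β n y ∧ (x = y ∨ x = y + (β - 1) / β ^ (n+1)) := by
  constructor
  · rintro ⟨I, rfl⟩
    refine ⟨_, ⟨fun k => I k.castSucc, rfl⟩, ?_⟩
    rw [Sapply_eq β hβ, Sapply_eq β hβ, Fin.sum_univ_castSucc]
    rcases eps_cases (I (Fin.last n)) with h | h <;> simp [h]
  · rintro ⟨y, ⟨I, rfl⟩, h | h⟩
    · refine ⟨Fin.snoc (α := fun _ => Fin 2) I 0, ?_⟩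
      rw [h, Sapply_eq β hβ, Sapply_eq β hβ, Fin.sum_univ_castSucc]
      simp [eps]
    · refine ⟨Fin.snoc (α := fun _ => Fin 2) I 1, ?_⟩
      rw [h, Sapply_eq β hβ, Sapply_eq β hβ, Fin.sum_univ_castSucc]
      simp [eps]

lemma multi_eq (m : ℕ) (β : ℝ)
    (hβ : β ^ m = ∑ j ∈ Finset.range m, β ^ j) : β ^ m * (2 - β) = 1 := by
  have := geom_sum_mul β m
  rw [← hβ] at this; linarith

lemma golden (m : ℕ) (hm : 2 ≤ m) (β : ℝ) (hβ1 : 1 < β) (hβ2 : β < 2)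
    (h : β ^ m * (2 - β) = 1) : β + 1 ≤ β ^ 2 := by
  have h2 : β ^ 2 ≤ β ^ m := pow_le_pow_right₀ hβ1.le hm
  have h3 : β ^ 2 * (2 - β) ≤ 1 := by
    rw [← h]; exact mul_le_mul_of_nonneg_right h2 (by linarith)
  nlinarith

/-- admissible scaled differences -/
def Good (m : ℕ) (β z : ℝ) : Prop :=
  z = 0 ∨ 1 ≤ |z| ∨ ∃ k < m, |z| = 1 - β ^ k * (2 - β)

lemma Good_neg {m : ℕ} {β z : ℝ} (h : Good m β z) : Good m β (-z) := by
  unfold Good at *; simpa using h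

lemma d_bounds (m : ℕ) (β : ℝ) (hβ1 : 1 < β) (hβ2 : β < 2)
    (h : β ^ m * (2 - β) = 1) (k : ℕ) (hk : k < m) :
    1 - 1 / β ≤ 1 - β ^ k * (2 - β) ∧ 1 - β ^ k * (2 - β) ≤ β - 1 := by
  have h1 : 1 ≤ β ^ k := one_le_pow₀ hβ1.le
  have h2 : β ^ (k+1) ≤ β ^ m := pow_le_pow_right₀ hβ1.le hk
  constructor
  · have : β ^ k * (2 - β) ≤ 1 / β := by
      rw [le_div_iff₀ (by linarith)]
      calc β ^ k * (2 - β) * β = β ^ (k+1) * (2 - β) := by ring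
        _ ≤ β ^ m * (2 - β) := mul_le_mul_of_nonneg_right h2 (by linarith)
        _ = 1 := h
    linarith
  · nlinarith

lemma Good_step_pos (m : ℕ) (hm : 2 ≤ m) (β : ℝ) (hβ1 : 1 < β) (hβ2 : β < 2)
    (h : β ^ m * (2 - β) = 1) (z : ℝ) (hz0 : 0 ≤ z) (hz : Good m β z) (s : ℝ)
    (hs : s = 0 ∨ s = 1 ∨ s = -1) : Good m β (β * z + s * (β - 1)) := by
  have hg := golden m hm β hβ1 hβ2 h
  have hd0 : |β - 1| = 1 - β ^ 0 * (2 - β) := by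
    rw [abs_of_pos (by linarith)]; ring
  rcases hz with hz | hz | ⟨k, hk, hz⟩
  · subst hz
    rcases hs with rfl | rfl | rfl
    · left; simp
    · right; right; exact ⟨0, by omega, by simpa using hd0⟩
    · right; right; refine ⟨0, by omega, ?_⟩
      rw [← hd0, ← abs_neg]; congr 1; ring
  · right; left
    rw [abs_of_nonneg hz0] at hz
    rw [le_abs]; left
    rcases hs with rfl | rfl | rfl <;> nlinarith
  · rw [abs_of_nonneg hz0] at hz
    obtain ⟨hb1, hb2⟩ := d_bounds m β hβ1 hβ2 h k hk
    rw [← hz] at hb1 hb2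
    have hb3 : β - 1 ≤ β * z := by
      have : β * (1 - 1 / β) ≤ β * z := mul_le_mul_of_nonneg_left hb1 (by linarith)
      have e : β * (1 - 1/β) = β - 1 := by field_simp
      linarith
    rcases hs with rfl | rfl | rfl
    · rcases Nat.lt_or_ge (k+1) m with hk' | hk'
      · obtain ⟨hc1, hc2⟩ := d_bounds m β hβ1 hβ2 h (k+1) hk'
        right; left
        rw [le_abs]; left
        have e : β * z = 1 - β ^ (k+1) * (2 - β) + (β - 1) := by rw [hz]; ring
        have : 1 + 1 / β ≤ β := by
          have : (β + 1) / β ≤ β := by rw [div_le_iff₀ (by linarith)]; nlinarith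
          have e2 : (β + 1) / β = 1 + 1 / β := by field_simp
          linarith
        linarith
      · have : k + 1 = m := by omega
        right; right; refine ⟨0, by omega, ?_⟩
        rw [← hd0]; congr 1
        have e : β * z = 1 - β ^ (k+1) * (2 - β) + (β - 1) := by rw [hz]; ring
        rw [this, h] at e; linarith
    · right; left
      rw [le_abs]; left
      nlinarith
    · have e : β * z = 1 - β ^ (k+1) * (2 - β) + (β - 1) := by rw [hz]; ring
      rcases Nat.lt_or_ge (k+1) m with hk' | hk'
      · right; right; refine ⟨k+1, hk', ?_⟩
        rw [abs_of_nonneg (by linarith)]; linarith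
      · have : k + 1 = m := by omega
        left; rw [this, h] at e; linarith

lemma Good_step (m : ℕ) (hm : 2 ≤ m) (β : ℝ) (hβ1 : 1 < β) (hβ2 : β < 2)
    (h : β ^ m * (2 - β) = 1) (z : ℝ) (hz : Good m β z) (s : ℝ)
    (hs : s = 0 ∨ s = 1 ∨ s = -1) : Good m β (β * z + s * (β - 1)) := by
  rcases le_total 0 z with h0 | h0
  · exact Good_step_pos m hm β hβ1 hβ2 h z h0 hz s hs
  · have := Good_neg (Good_step_pos m hm β hβ1 hβ2 h (-z) (by linarith) (Good_neg hz) (-s)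
      (by rcases hs with rfl | rfl | rfl <;> simp))
    convert this using 1; ring

lemma PP_good (m : ℕ) (hm : 2 ≤ m) (β : ℝ) (hβ1 : 1 < β) (hβ2 : β < 2)
    (h : β ^ m * (2 - β) = 1) (n : ℕ) : ∀ x y, PP β n x → PP β n y →
    Good m β (β ^ n * (x - y)) := by
  have hb : β ≠ 0 := by positivity
  induction n with
  | zero => intro x y hx hy; rw [PP_zero] at hx hy; subst hx hy; left; simp
  | succ n ih =>
    intro x y hx hy
    rw [PP_succ β hβ1] at hx hy
    obtain ⟨x', hx', hx⟩ := hx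
    obtain ⟨y', hy', hy⟩ := hy
    have key := Good_step m hm β hβ1 hβ2 h _ (ih x' y' hx' hy')
    have e : β ^ (n+1) * ((β - 1) / β ^ (n+1)) = β - 1 := by field_simp
    rcases hx with rfl | rfl <;> rcases hy with rfl | rfl
    · convert key 0 (by simp) using 1; ring
    · convert key (-1) (by simp) using 1
      linear_combination -e
    · convert key 1 (by simp) using 1
      linear_combination e
    · convert key 0 (by simp) using 1; ring

/-- two-point gap dichotomy -/
lemma PP_gap (m : ℕ) (hm : 2 ≤ m) (β : ℝ) (hβ1 : 1 < β) (hβ2 : β < 2)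
    (h : β ^ m * (2 - β) = 1) (n : ℕ) (x y : ℝ) (hx : PP β n x) (hy : PP β n y) (hxy : x < y) :
    1 / β ^ n ≤ y - x ∨ ((1 - 1 / β) * (1 / β ^ n) ≤ y - x ∧ y - x ≤ (β - 1) * (1 / β ^ n)) := by
  have hp : 0 < β ^ n := by positivity
  have hpos : 0 < β ^ n * (y - x) := mul_pos hp (by linarith)
  have e : y - x = β ^ n * (y - x) * (1 / β ^ n) := by field_simp
  have hi : 0 ≤ 1 / β ^ n := by positivity
  rcases PP_good m hm β hβ1 hβ2 h n y x hy hx with hz | hz | ⟨k, hk, hz⟩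
  · linarith
  · left; rw [abs_of_pos hpos] at hz
    rw [e]; nlinarith
  · right; rw [abs_of_pos hpos] at hz
    obtain ⟨hb1, hb2⟩ := d_bounds m β hβ1 hβ2 h k hk
    rw [← hz] at hb1 hb2
    rw [e]
    exact ⟨mul_le_mul_of_nonneg_right hb1 hi, mul_le_mul_of_nonneg_right hb2 hi⟩

lemma PP_sep (m : ℕ) (hm : 2 ≤ m) (β : ℝ) (hβ1 : 1 < β) (hβ2 : β < 2)
    (h : β ^ m * (2 - β) = 1) (n : ℕ) (x y : ℝ) (hx : PP β n x) (hy : PP β n y) (hxy : x < y) :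
    (1 - 1 / β) * (1 / β ^ n) ≤ y - x := by
  have hi : 0 ≤ 1 / β ^ n := by positivity
  have : 0 < 1 / β := by positivity
  rcases PP_gap m hm β hβ1 hβ2 h n x y hx hy hxy with h1 | ⟨h1, _⟩
  · nlinarith
  · exact h1

lemma PP_three (m : ℕ) (hm : 2 ≤ m) (β : ℝ) (hβ1 : 1 < β) (hβ2 : β < 2)
    (h : β ^ m * (2 - β) = 1) (n : ℕ) (x y z : ℝ) (hx : PP β n x) (hy : PP β n y) (hz : PP β n z)
    (hxy : x < y) (hyz : y < z) : 1 / β ^ n ≤ z - x := by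
  have hi : 0 < 1 / β ^ n := by positivity
  rcases PP_gap m hm β hβ1 hβ2 h n x z hx hz (hxy.trans hyz) with h1 | ⟨_, h1⟩
  · exact h1
  · have h2 := PP_sep m hm β hβ1 hβ2 h n x y hx hy hxy
    have h3 := PP_sep m hm β hβ1 hβ2 h n y z hy hz hyz
    exfalso
    have h4 : β - 1 < 2 * (1 - 1 / β) := by
      have : 2 * (1 - 1 / β) = 2 * (β - 1) / β := by field_simp
      rw [this, lt_div_iff₀ (by linarith)]; nlinarith
    nlinarith

lemma PP_range (β : ℝ) (hβ1 : 1 < β) (n : ℕ) : ∀ x, PP β n x → 0 ≤ x ∧ x ≤ 1 - 1 / β ^ n := by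
  induction n with
  | zero => intro x hx; rw [PP_zero] at hx; subst hx; simp
  | succ n ih =>
    intro x hx
    rw [PP_succ β hβ1] at hx
    obtain ⟨y, hy, hx⟩ := hx
    obtain ⟨h0, h1⟩ := ih y hy
    have hi : 0 < 1 / β ^ (n+1) := by positivity
    have e : 1 / β ^ n = β * (1 / β ^ (n+1)) := by field_simp; ring
    have e2 : (β - 1) / β ^ (n+1) = (β - 1) * (1 / β ^ (n+1)) := by ring
    rw [e] at h1
    rcases hx with rfl | rfl
    · exact ⟨h0, by nlinarith⟩
    · rw [e2]; exact ⟨by nlinarith, by nlinarith⟩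

lemma PP_next (β : ℝ) (hβ1 : 1 < β) (hβ2 : β < 2) (n : ℕ) : ∀ x, PP β n x → x ≠ 1 - 1 / β ^ n →
    ∃ y, PP β n y ∧ x < y ∧ y ≤ x + (β - 1) * (1 / β ^ n) := by
  induction n with
  | zero => intro x hx; rw [PP_zero] at hx; subst hx; simp
  | succ n ih =>
    intro x hx hne
    rw [PP_succ β hβ1] at hx
    have hi : 0 < 1 / β ^ (n+1) := by positivity
    have e : 1 / β ^ n = β * (1 / β ^ (n+1)) := by field_simp; ring
    have e2 : (β - 1) / β ^ (n+1) = (β - 1) * (1 / β ^ (n+1)) := by ring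
    have hd : 0 < (β - 1) * (1 / β ^ (n+1)) := mul_pos (by linarith) hi
    obtain ⟨y, hy, rfl | rfl⟩ := hx
    · refine ⟨x + (β - 1) / β ^ (n+1), (PP_succ β hβ1 n _).2 ⟨x, hy, Or.inr rfl⟩, ?_, ?_⟩ <;>
        rw [e2] <;> linarith
    · have : y ≠ 1 - 1 / β ^ n := by
        rintro rfl; apply hne; rw [e, e2]; ring
      obtain ⟨z, hz, h1, h2⟩ := ih y hy this
      rw [e] at h2
      rw [e2]
      by_cases hc : y + (β - 1) * (1 / β ^ (n+1)) < z
      · refine ⟨z, (PP_succ β hβ1 n _).2 ⟨z, hz, Or.inl rfl⟩, hc, ?_⟩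
        nlinarith
      · refine ⟨z + (β - 1) / β ^ (n+1), (PP_succ β hβ1 n _).2 ⟨z, hz, Or.inr rfl⟩, ?_, ?_⟩ <;>
          rw [e2] <;> linarith
lemma Smap_meas (β : ℝ) (i : Fin 2) : Measurable (Smap β i) := by
  have : Smap β i = fun x => x / β + eps i * (1 - 1 / β) := funext (Smap_eq β i)
  rw [this]; fun_prop

lemma Sapply_meas (β : ℝ) (hβ : 1 < β) {n : ℕ} (I : Fin n → Fin 2) : Measurable (Sapply β I) := by
  have : Sapply β I = fun x => Sapply β I 0 + x / β ^ n := funext (Sapply_affine β hβ n I)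
  rw [this]; fun_prop

/-- weight of a word -/
def pword (p1 p2 : ℝ) {n : ℕ} (I : Fin n → Fin 2) : ℝ := ∏ k, pw p1 p2 (I k)

lemma pw_pos {p1 p2 : ℝ} (hp1 : 0 < p1) (hp2 : 0 < p2) (i : Fin 2) : 0 < pw p1 p2 i := by
  unfold pw; split_ifs <;> assumption

lemma pword_pos {p1 p2 : ℝ} (hp1 : 0 < p1) (hp2 : 0 < p2) {n : ℕ} (I : Fin n → Fin 2) :
    0 < pword p1 p2 I := Finset.prod_pos fun _ _ => pw_pos hp1 hp2 _

lemma sum_words (n : ℕ) (f : (Fin (n+1) → Fin 2) → ℝ) :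
    ∑ I, f I = ∑ i : Fin 2, ∑ J : Fin n → Fin 2, f (Fin.cons (α := fun _ => Fin 2) i J) := by
  rw [← Fintype.sum_prod_type']
  exact (Fintype.sum_equiv (Fin.consEquiv (fun _ : Fin (n+1) => Fin 2)) _ _ (fun _ => rfl)).symm

lemma pword_cons (p1 p2 : ℝ) {n : ℕ} (i : Fin 2) (J : Fin n → Fin 2) :
    pword p1 p2 (Fin.cons (α := fun _ => Fin 2) i J) = pw p1 p2 i * pword p1 p2 J := by
  simp [pword, Fin.prod_univ_succ]

lemma Sapply_cons (β : ℝ) {n : ℕ} (i : Fin 2) (J : Fin n → Fin 2) (x : ℝ) :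
    Sapply β (Fin.cons (α := fun _ => Fin 2) i J) x = Smap β i (Sapply β J x) := by
  simp [Sapply]

section meas
variable {β p1 p2 : ℝ} {μ : Measure ℝ} [IsProbabilityMeasure μ]

lemma mu_one (hp1 : 0 < p1) (hp2 : 0 < p2)
    (hμ : μ = ENNReal.ofReal p1 • μ.map (Smap β 0) + ENNReal.ofReal p2 • μ.map (Smap β 1))
    (A : Set ℝ) (hA : MeasurableSet A) :
    μ.real A = ∑ i : Fin 2, pw p1 p2 i * μ.real (Smap β i ⁻¹' A) := by
  have h : μ A = ENNReal.ofReal p1 * μ (Smap β 0 ⁻¹' A) + ENNReal.ofReal p2 * μ (Smap β 1 ⁻¹' A) := by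
    conv_lhs => rw [hμ]
    simp [Measure.map_apply (Smap_meas β _) hA]
  simp only [Measure.real, h, Fin.sum_univ_two, pw]
  rw [ENNReal.toReal_add (by finiteness) (by finiteness)]
  simp [hp1.le, hp2.le]

lemma mu_iter (hp1 : 0 < p1) (hp2 : 0 < p2)
    (hμ : μ = ENNReal.ofReal p1 • μ.map (Smap β 0) + ENNReal.ofReal p2 • μ.map (Smap β 1))
    (n : ℕ) : ∀ (A : Set ℝ), MeasurableSet A →
    μ.real A = ∑ I : Fin n → Fin 2, pword p1 p2 I * μ.real (Sapply β I ⁻¹' A) := by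
  induction n with
  | zero =>
    intro A hA
    have : ∀ I : Fin 0 → Fin 2, Sapply β I ⁻¹' A = A := by
      intro I; ext x; simp [Sapply]
    simp [pword, this]
  | succ n ih =>
    intro A hA
    rw [mu_one hp1 hp2 hμ A hA, sum_words]
    refine Finset.sum_congr rfl fun i _ => ?_
    rw [ih _ (Smap_meas β i hA), Finset.mul_sum]
    refine Finset.sum_congr rfl fun J _ => ?_
    rw [pword_cons, mul_assoc]
    have : Sapply β (Fin.cons (α := fun _ => Fin 2) i J) ⁻¹' A
        = Sapply β J ⁻¹' (Smap β i ⁻¹' A) := by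
      ext x; simp [Sapply_cons]
    rw [this]

lemma mu_tail (hβ : 1 < β) (hp1 : 0 < p1) (hp2 : 0 < p2) (hp : p1 + p2 = 1)
    (hμ : μ = ENNReal.ofReal p1 • μ.map (Smap β 0) + ENNReal.ofReal p2 • μ.map (Smap β 1))
    (s : ℝ) (hs : 0 < s) : μ.real {x | s < |x - 1/2| - 1/2} = 0 := by
  have hmeas : ∀ s : ℝ, MeasurableSet {x : ℝ | s < |x - 1/2| - 1/2} := fun s =>
    measurableSet_lt measurable_const (by fun_prop)
  have step : ∀ s : ℝ, μ.real {x | s < |x - 1/2| - 1/2} ≤ μ.real {x | β * s < |x - 1/2| - 1/2} := by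
    intro s
    rw [mu_one hp1 hp2 hμ _ (hmeas s)]
    have : ∀ i, μ.real (Smap β i ⁻¹' {x | s < |x - 1/2| - 1/2}) ≤
        μ.real {x | β * s < |x - 1/2| - 1/2} := by
      intro i
      apply measureReal_mono _ (by finiteness)
      intro x hx
      simp only [Set.mem_preimage, Set.mem_ofPred_eq] at hx ⊢
      have hb : 0 < β := by linarith
      have e : β * |Smap β i x - 1/2| = |(x - 1/2) + (2 * eps i - 1) * (β - 1) / 2| := by
        rw [← abs_of_pos hb, ← abs_mul, abs_of_pos hb, Smap_eq]
        congr 1; field_simp; ring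
      have e2 : |(2 * eps i - 1) * (β - 1) / 2| = (β - 1) / 2 := by
        rcases eps_cases i with h | h <;> rw [h]
        · rw [abs_of_nonpos] <;> linarith
        · rw [abs_of_nonneg] <;> linarith
      have := abs_add_le (x - 1/2) ((2 * eps i - 1) * (β - 1) / 2)
      rw [← e, e2] at this
      nlinarith
    rw [Fin.sum_univ_two]
    have h0 := this 0
    have h1 := this 1
    simp only [pw, if_true, one_ne_zero, if_false]
    have h2 := mul_le_mul_of_nonneg_left h0 hp1.le
    have h3 := mul_le_mul_of_nonneg_left h1 hp2.le
    have h4 : p1 * μ.real {x | β * s < |x - 1/2| - 1/2} + p2 * μ.real {x | β * s < |x - 1/2| - 1/2}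
        = μ.real {x | β * s < |x - 1/2| - 1/2} := by rw [← add_mul, hp, one_mul]
    linarith
  have iter : ∀ n : ℕ, μ.real {x | s < |x - 1/2| - 1/2} ≤
      μ.real {x | β ^ n * s < |x - 1/2| - 1/2} := by
    intro n
    induction n with
    | zero => simp
    | succ n ih =>
      refine ih.trans ((step _).trans (le_of_eq ?_))
      congr 2; ext x; rw [pow_succ']; ring_nf
  have hanti : Antitone fun n : ℕ => {x : ℝ | β ^ n * s < |x - 1/2| - 1/2} := by
    intro a b hab x hx
    simp only [Set.mem_ofPred_eq] at hx ⊢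
    have : β ^ a ≤ β ^ b := pow_le_pow_right₀ hβ.le hab
    nlinarith
  have hlim := tendsto_measure_iInter_atTop (μ := μ)
    (s := fun n : ℕ => {x : ℝ | β ^ n * s < |x - 1/2| - 1/2})
    (fun n => (hmeas _).nullMeasurableSet) hanti ⟨0, by finiteness⟩
  have hempty : (⋂ n : ℕ, {x : ℝ | β ^ n * s < |x - 1/2| - 1/2}) = ∅ := by
    ext x
    simp only [Set.mem_iInter, Set.mem_ofPred_eq, Set.mem_empty_iff_false, iff_false, not_forall, not_lt]
    obtain ⟨n, hn⟩ := pow_unbounded_of_one_lt ((|x - 1/2| - 1/2) / s) hβ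
    exact ⟨n, by rw [div_lt_iff₀ hs] at hn; linarith⟩
  rw [hempty, measure_empty] at hlim
  have hle : μ {x | s < |x - 1/2| - 1/2} ≤ 0 := by
    apply ge_of_tendsto' hlim
    intro n
    exact (ENNReal.toReal_le_toReal (measure_ne_top _ _) (measure_ne_top _ _)).1 (iter n)
  rw [Measure.real, nonpos_iff_eq_zero.1 hle]; rfl

lemma mu_supp (hβ : 1 < β) (hp1 : 0 < p1) (hp2 : 0 < p2) (hp : p1 + p2 = 1)
    (hμ : μ = ENNReal.ofReal p1 • μ.map (Smap β 0) + ENNReal.ofReal p2 • μ.map (Smap β 1)) :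
    μ (Set.Icc 0 1)ᶜ = 0 := by
  have : (Set.Icc (0:ℝ) 1)ᶜ ⊆ ⋃ n : ℕ, {x : ℝ | 1 / ((n:ℝ) + 1) < |x - 1/2| - 1/2} := by
    intro x hx
    have h0 : 0 < |x - 1/2| - 1/2 := by
      by_contra hc
      apply hx
      have := abs_le.1 (show |x - 1/2| ≤ 1/2 by linarith)
      exact ⟨by linarith [this.1], by linarith [this.2]⟩
    obtain ⟨n, hn⟩ := exists_nat_one_div_lt h0
    exact Set.mem_iUnion.2 ⟨n, hn⟩
  refine measure_mono_null this (measure_iUnion_null fun n => ?_)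
  have := mu_tail hβ hp1 hp2 hp hμ (1 / ((n:ℝ) + 1)) (by positivity)
  exact (measureReal_eq_zero_iff).1 this

/-- adding a null set -/
lemma mu_le_inter (hs : μ (Set.Icc 0 1)ᶜ = 0) (A B : Set ℝ) (h : A ∩ Set.Icc 0 1 ⊆ B) :
    μ.real A ≤ μ.real B := by
  have h1 : μ A ≤ μ B := by
    calc μ A ≤ μ (B ∪ (Set.Icc 0 1)ᶜ) := by
          apply measure_mono
          intro x hx
          by_cases hx' : x ∈ Set.Icc (0:ℝ) 1
          · exact Or.inl (h ⟨hx, hx'⟩)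
          · exact Or.inr hx'
      _ ≤ μ B + μ (Set.Icc 0 1)ᶜ := measure_union_le _ _
      _ = μ B := by rw [hs, add_zero]
  exact (ENNReal.toReal_le_toReal (by finiteness) (by finiteness)).2 h1

lemma Wn_pword (n : ℕ) (x : ℝ) :
    Wn β p1 p2 n x = ∑ I : Fin n → Fin 2, if Sapply β I 0 = x then pword p1 p2 I else 0 := rfl

lemma Wn_nonneg (hp1 : 0 < p1) (hp2 : 0 < p2) (n : ℕ) (x : ℝ) : 0 ≤ Wn β p1 p2 n x := by
  rw [Wn_pword]
  refine Finset.sum_nonneg fun I _ => ?_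
  split_ifs
  · exact (pword_pos hp1 hp2 I).le
  · exact le_rfl

lemma Wn_pos (hp1 : 0 < p1) (hp2 : 0 < p2) (n : ℕ) (x : ℝ) (hx : PP β n x) :
    0 < Wn β p1 p2 n x := by
  obtain ⟨I, hI⟩ := hx
  rw [Wn_pword]
  refine Finset.sum_pos' (fun I _ => ?_) ⟨I, Finset.mem_univ _, ?_⟩
  · split_ifs
    · exact (pword_pos hp1 hp2 I).le
    · exact le_rfl
  · rw [if_pos hI]; exact pword_pos hp1 hp2 I

/-- lower bound -/
lemma mu_lower (hβ : 1 < β) (hp1 : 0 < p1) (hp2 : 0 < p2)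
    (hμ : μ = ENNReal.ofReal p1 • μ.map (Smap β 0) + ENNReal.ofReal p2 • μ.map (Smap β 1))
    (n : ℕ) (x : ℝ) (A : Set ℝ) (hA : MeasurableSet A) :
    Wn β p1 p2 n x * μ.real ((fun t => x + t / β ^ n) ⁻¹' A) ≤ μ.real A := by
  rw [mu_iter hp1 hp2 hμ n A hA, Wn_pword, Finset.sum_mul]
  refine Finset.sum_le_sum fun I _ => ?_
  split_ifs with h
  · apply le_of_eq
    have : Sapply β I = fun t => x + t / β ^ n := by
      funext t; rw [Sapply_affine β hβ, h]
    rw [this]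
  · rw [zero_mul]; exact mul_nonneg (pword_pos hp1 hp2 I).le measureReal_nonneg

/-- upper bound -/
lemma mu_upper (hβ : 1 < β) (hp1 : 0 < p1) (hp2 : 0 < p2) (hs : μ (Set.Icc 0 1)ᶜ = 0)
    (hμ : μ = ENNReal.ofReal p1 • μ.map (Smap β 0) + ENNReal.ofReal p2 • μ.map (Smap β 1))
    (n : ℕ) (u v : ℝ) (T : Finset ℝ)
    (hT : ∀ x, PP β n x → x ≤ v → u ≤ x + 1 / β ^ n → x ∈ T) :
    μ.real (Set.Icc u v) ≤ ∑ x ∈ T, Wn β p1 p2 n x := by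
  rw [mu_iter hp1 hp2 hμ n _ measurableSet_Icc]
  simp only [Wn_pword]
  rw [Finset.sum_comm]
  refine Finset.sum_le_sum fun I _ => ?_
  have hpos := pword_pos hp1 hp2 I
  rw [Finset.sum_ite_eq]
  split_ifs with h
  · have : μ.real (Sapply β I ⁻¹' Set.Icc u v) ≤ 1 := measureReal_le_one
    nlinarith
  · have h0 : μ.real (Sapply β I ⁻¹' Set.Icc u v) ≤ μ.real (∅ : Set ℝ) := by
      apply mu_le_inter hs
      rintro t ⟨ht, ht0, ht1⟩
      exfalso
      apply h
      rw [Set.mem_preimage, Sapply_affine β hβ] at ht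
      have hb : 0 < β ^ n := by positivity
      have h1 : 0 ≤ t / β ^ n := by positivity
      have h2 : t / β ^ n ≤ 1 / β ^ n := div_le_div_of_nonneg_right ht1 hb.le
      exact hT _ ⟨I, rfl⟩ (by linarith [ht.2]) (by linarith [ht.1])
    rw [measureReal_empty] at h0
    nlinarith

lemma cover (hβ1 : 1 < β) (hβ2 : β < 2) (n : ℕ) : ∀ y : ℝ, 0 ≤ y → y ≤ 1 →
    ∃ I : Fin n → Fin 2, Sapply β I 0 ≤ y ∧ y ≤ Sapply β I 0 + 1 / β ^ n := by
  induction n with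
  | zero => intro y h0 h1; exact ⟨fun _ => 0, by simpa [Sapply], by simpa [Sapply]⟩
  | succ n ih =>
    intro y h0 h1
    have hb : 0 < β := by linarith
    have : ∃ i : Fin 2, 0 ≤ β * y - eps i * (β - 1) ∧ β * y - eps i * (β - 1) ≤ 1 := by
      by_cases hc : β * y ≤ 1
      · exact ⟨0, by simp [eps]; positivity, by simpa [eps] using hc⟩
      · exact ⟨1, by simp [eps]; linarith, by simp [eps]; nlinarith⟩
    obtain ⟨i, h2, h3⟩ := this
    obtain ⟨J, h4, h5⟩ := ih _ h2 h3
    refine ⟨Fin.cons (α := fun _ => Fin 2) i J, ?_, ?_⟩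
    · rw [Sapply_cons, Smap_eq]
      have : β * (Sapply β J 0 / β + eps i * (1 - 1 / β)) = Sapply β J 0 + eps i * (β - 1) := by
        field_simp
      refine le_of_mul_le_mul_left ?_ hb
      rw [this]; linarith
    · rw [Sapply_cons, Smap_eq]
      have : β * (Sapply β J 0 / β + eps i * (1 - 1 / β) + 1 / β ^ (n+1)) =
          Sapply β J 0 + 1 / β ^ n + eps i * (β - 1) := by
        field_simp; ring
      refine le_of_mul_le_mul_left ?_ hb
      rw [this]; linarith

lemma W_le_mu (hβ : 1 < β) (hp1 : 0 < p1) (hp2 : 0 < p2) (hs : μ (Set.Icc 0 1)ᶜ = 0)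
    (hμ : μ = ENNReal.ofReal p1 • μ.map (Smap β 0) + ENNReal.ofReal p2 • μ.map (Smap β 1))
    (n : ℕ) (x : ℝ) (A : Set ℝ) (hA : MeasurableSet A) (h : Set.Icc x (x + 1 / β ^ n) ⊆ A) :
    Wn β p1 p2 n x ≤ μ.real A := by
  refine le_trans ?_ (mu_lower hβ hp1 hp2 hμ n x A hA)
  have h1 : μ.real (Set.univ : Set ℝ) ≤ μ.real ((fun t => x + t / β ^ n) ⁻¹' A) := by
    apply mu_le_inter hs
    rintro t ⟨_, ht0, ht1⟩
    have hb : 0 < β ^ n := by positivity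
    have h1 : 0 ≤ t / β ^ n := by positivity
    have h2 : t / β ^ n ≤ 1 / β ^ n := div_le_div_of_nonneg_right ht1 hb.le
    exact h ⟨by linarith, by linarith⟩
  rw [probReal_univ] at h1
  have := Wn_nonneg (β := β) hp1 hp2 n x
  nlinarith

/-- uniform full support -/
lemma full_supp (hβ1 : 1 < β) (hβ2 : β < 2) (hp1 : 0 < p1) (hp2 : 0 < p2)
    (hs : μ (Set.Icc 0 1)ᶜ = 0)
    (hμ : μ = ENNReal.ofReal p1 • μ.map (Smap β 0) + ENNReal.ofReal p2 • μ.map (Smap β 1))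
    (η : ℝ) (hη : 0 < η) : ∃ c : ℝ, 0 < c ∧ c ≤ 1 ∧ ∀ y u v : ℝ, 0 ≤ y → y ≤ 1 →
      u ≤ y - η → y + η ≤ v → c ≤ μ.real (Set.Icc u v) := by
  obtain ⟨n, hn⟩ := pow_unbounded_of_one_lt (1 / η) hβ1
  have hb : 0 < β ^ n := by positivity
  have hn' : 1 / β ^ n ≤ η := by
    rw [div_lt_iff₀ hη] at hn
    rw [div_le_iff₀ hb]; linarith
  obtain ⟨I0, _, hI0⟩ := Finset.exists_min_image (Finset.univ : Finset (Fin n → Fin 2))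
    (fun I => pword p1 p2 I) ⟨fun _ => 0, Finset.mem_univ _⟩
  refine ⟨min 1 (pword p1 p2 I0), lt_min one_pos (pword_pos hp1 hp2 I0), min_le_left _ _, ?_⟩
  intro y u v h0 h1 hu hv
  obtain ⟨I, h2, h3⟩ := cover hβ1 hβ2 n y h0 h1
  refine (min_le_right _ _).trans ((hI0 I (Finset.mem_univ _)).trans ?_)
  refine le_trans ?_ (W_le_mu hβ1 hp1 hp2 hs hμ n (Sapply β I 0) _ measurableSet_Icc ?_)
  · rw [Wn_pword]
    have := Finset.single_le_sum (f := fun J : Fin n → Fin 2 =>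
      if Sapply β J 0 = Sapply β I 0 then pword p1 p2 J else 0) (s := Finset.univ)
      (fun J _ => by
        show 0 ≤ (if Sapply β J 0 = Sapply β I 0 then pword p1 p2 J else 0)
        split_ifs
        · exact (pword_pos hp1 hp2 J).le
        · exact le_rfl) (Finset.mem_univ I)
    simpa using this
  · apply Set.Icc_subset_Icc <;> linarith

/-- a weighted point bounds the mass of a subinterval from below -/
lemma mu_sub (hβ1 : 1 < β) (hβ2 : β < 2) (hp1 : 0 < p1) (hp2 : 0 < p2)
    (hs : μ (Set.Icc 0 1)ᶜ = 0)
    (hμ : μ = ENNReal.ofReal p1 • μ.map (Smap β 0) + ENNReal.ofReal p2 • μ.map (Smap β 1))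
    (η : ℝ) (hη : 0 < η) : ∃ c : ℝ, 0 < c ∧ c ≤ 1 ∧ ∀ (n : ℕ) (x y u v : ℝ),
      x ≤ y → y ≤ x + 1 / β ^ n →
      u ≤ y - η * (1 / β ^ n) → y + η * (1 / β ^ n) ≤ v →
      c * Wn β p1 p2 n x ≤ μ.real (Set.Icc u v) := by
  obtain ⟨c, hc, hc1, H⟩ := full_supp hβ1 hβ2 hp1 hp2 hs hμ η hη
  refine ⟨c, hc, hc1, fun n x y u v h0 h1 hu hv => ?_⟩
  refine le_trans ?_ (mu_lower hβ1 hp1 hp2 hμ n x _ measurableSet_Icc)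
  have hb : 0 < β ^ n := by positivity
  have e : (fun t => x + t / β ^ n) ⁻¹' Set.Icc u v = Set.Icc (β ^ n * (u - x)) (β ^ n * (v - x)) := by
    ext t
    simp only [Set.mem_preimage, Set.mem_Icc]
    constructor
    · rintro ⟨h1, h2⟩
      have e : t = β ^ n * (t / β ^ n) := by field_simp
      rw [e]
      exact ⟨mul_le_mul_of_nonneg_left (by linarith) hb.le, mul_le_mul_of_nonneg_left (by linarith) hb.le⟩
    · rintro ⟨h1, h2⟩
      have h3 : u - x ≤ t / β ^ n := by rw [le_div_iff₀ hb]; linarith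
      have h4 : t / β ^ n ≤ v - x := by rw [div_le_iff₀ hb]; linarith
      exact ⟨by linarith, by linarith⟩
  rw [e, mul_comm]
  refine mul_le_mul_of_nonneg_left ?_ (Wn_nonneg hp1 hp2 n x)
  have e1 : β ^ n * (1 / β ^ n) = 1 := by field_simp
  apply H (β ^ n * (y - x))
  · exact mul_nonneg hb.le (by linarith)
  · calc β ^ n * (y - x) ≤ β ^ n * (1 / β ^ n) := mul_le_mul_of_nonneg_left (by linarith) hb.le
      _ = 1 := e1
  · have : β ^ n * (u - x) ≤ β ^ n * (y - x - η * (1 / β ^ n)) :=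
      mul_le_mul_of_nonneg_left (by linarith) hb.le
    have e2 : β ^ n * (y - x - η * (1 / β ^ n)) = β ^ n * (y - x) - η := by
      linear_combination (-η) * e1
    linarith
  · have : β ^ n * (y - x + η * (1 / β ^ n)) ≤ β ^ n * (v - x) :=
      mul_le_mul_of_nonneg_left (by linarith) hb.le
    have e2 : β ^ n * (y - x + η * (1 / β ^ n)) = β ^ n * (y - x) + η := by
      linear_combination η * e1
    linarith

lemma Wn_zero_ge (n : ℕ) (hp1 : 0 < p1) (hp2 : 0 < p2) : p1 ^ n ≤ Wn β p1 p2 n 0 := by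
  have hS : ∀ n, Sapply β (fun _ : Fin n => (0 : Fin 2)) 0 = 0 := by
    intro n
    induction n with
    | zero => simp [Sapply]
    | succ n ih => rw [Sapply, ih]; simp [Smap]
  rw [Wn_pword]
  have := Finset.single_le_sum (f := fun J : Fin n → Fin 2 =>
      if Sapply β J 0 = 0 then pword p1 p2 J else 0) (s := Finset.univ)
      (fun J _ => by
        show 0 ≤ (if Sapply β J 0 = 0 then pword p1 p2 J else 0)
        split_ifs
        · exact (pword_pos hp1 hp2 J).le
        · exact le_rfl) (Finset.mem_univ (fun _ => (0 : Fin 2)))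
  simpa [hS, pword, pw] using this

lemma Wn_small_le (hβ1 : 1 < β) (hp1 : 0 < p1) (hp2 : 0 < p2) (hp : p1 + p2 = 1) (n : ℕ) :
    ∀ x : ℝ, x ≤ (β - 1) * (1 / β ^ (n+1)) → Wn β p1 p2 (n+1) x ≤ p1 ^ n := by
  induction n with
  | zero =>
    intro x _
    rw [Wn_pword, sum_words]
    have hle : ∀ (i : Fin 2) (J : Fin 0 → Fin 2),
      (if Sapply β (Fin.cons (α := fun _ => Fin 2) i J) 0 = x
        then pword p1 p2 (Fin.cons (α := fun _ => Fin 2) i J) else 0) ≤ pw p1 p2 i := by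
      intro i J
      have := pw_pos hp1 hp2 i
      rw [pword_cons]
      split_ifs
      · simp [pword]
      · exact this.le
    calc _ ≤ ∑ i : Fin 2, ∑ J : Fin 0 → Fin 2, pw p1 p2 i :=
          Finset.sum_le_sum fun i _ => Finset.sum_le_sum fun J _ => hle i J
      _ = p1 ^ 0 := by simp [Fin.sum_univ_two, pw, hp]
  | succ n ih =>
    intro x hx
    have hb : 0 < β := by linarith
    have hle : ∀ J : Fin (n+1) → Fin 2, Sapply β J 0 / β = x ↔ Sapply β J 0 = β * x := by
      intro J; rw [div_eq_iff hb.ne', mul_comm]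
    have hno : ∀ J : Fin (n+1) → Fin 2, ¬ (Sapply β J 0 / β + (1 - 1 / β) = x) := by
      intro J hJ
      have h0 := (PP_range β hβ1 (n+1) _ ⟨J, rfl⟩).1
      have h1 : 0 ≤ Sapply β J 0 / β := by positivity
      have h2 : 1 / β ^ (n+1+1) < 1 / β := by
        apply one_div_lt_one_div_of_lt hb
        calc β = β ^ 1 := (pow_one β).symm
          _ < β ^ (n+1+1) := pow_lt_pow_right₀ hβ1 (by omega)
      have h3 : (β - 1) * (1 / β ^ (n+1+1)) < (β - 1) * (1 / β) :=
        mul_lt_mul_of_pos_left h2 (by linarith)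
      have h4 : (β - 1) * (1 / β) = 1 - 1 / β := by field_simp
      linarith
    rw [Wn_pword, sum_words, Fin.sum_univ_two]
    simp only [Sapply_cons, Smap, if_true, one_ne_zero, if_false, hle, hno, Finset.sum_const_zero,
      add_zero, pword_cons]
    have e : ∑ J : Fin (n+1) → Fin 2, (if Sapply β J 0 = β * x then pw p1 p2 0 * pword p1 p2 J else 0)
        = p1 * Wn β p1 p2 (n+1) (β * x) := by
      rw [Wn_pword, Finset.mul_sum]
      refine Finset.sum_congr rfl fun J _ => ?_
      split_ifs <;> simp [pw]
    rw [e, pow_succ']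
    refine mul_le_mul_of_nonneg_left (ih _ ?_) hp1.le
    have e : (β - 1) * (1 / β ^ (n+1)) = β * ((β - 1) * (1 / β ^ (n+1+1))) := by
      field_simp; ring
    rw [e]; exact mul_le_mul_of_nonneg_left hx hb.le

end meas
section enum
variable {β : ℝ} {n : ℕ}

lemma pt_eq (j : ℕ) (hj : j < (Xn β n).card) :
    pt β n j = (Xn β n).orderEmbOfFin rfl ⟨j, hj⟩ := by
  rw [Finset.orderEmbOfFin_apply]
  unfold pt
  rw [List.getD_eq_getElem _ _ (by simpa using hj)]
  rfl

lemma pt_lt {i j : ℕ} (hij : i < j) (hj : j < (Xn β n).card) : pt β n i < pt β n j := by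
  rw [pt_eq j hj, pt_eq i (hij.trans hj)]
  exact (OrderEmbedding.lt_iff_lt _).2 hij

lemma pt_le {i j : ℕ} (hij : i ≤ j) (hj : j < (Xn β n).card) : pt β n i ≤ pt β n j := by
  rcases hij.eq_or_lt with rfl | h
  · exact le_rfl
  · exact (pt_lt h hj).le

lemma lt_of_pt_lt {i j : ℕ} (hi : i < (Xn β n).card)
    (h : pt β n i < pt β n j) : i < j := by
  by_contra hc
  exact absurd (pt_le (not_lt.1 hc) hi) (not_le.2 h)

lemma mem_Xn (x : ℝ) : x ∈ Xn β n ↔ PP β n x ∨ x = 1 := by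
  simp [Xn, PP, or_comm]

lemma pt_mem (j : ℕ) (hj : j < (Xn β n).card) : PP β n (pt β n j) ∨ pt β n j = 1 := by
  rw [← mem_Xn, pt_eq j hj]
  exact Finset.orderEmbOfFin_mem _ _ _

lemma pt_surj (x : ℝ) (hx : PP β n x ∨ x = 1) : ∃ j < (Xn β n).card, pt β n j = x := by
  rw [← mem_Xn] at hx
  have : x ∈ Set.range ((Xn β n).orderEmbOfFin rfl) := by
    rw [Finset.range_orderEmbOfFin]; exact hx
  obtain ⟨j, hj⟩ := this
  exact ⟨j, j.2, by rw [pt_eq j j.2]; exact hj⟩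

lemma PP_lt_one (hβ1 : 1 < β) {x : ℝ} (hx : PP β n x) : x < 1 := by
  have := (PP_range β hβ1 n x hx).2
  have h : 0 < 1 / β ^ n := by positivity
  linarith

lemma pt_le_one (hβ1 : 1 < β) (j : ℕ) (hj : j < (Xn β n).card) : pt β n j ≤ 1 := by
  rcases pt_mem j hj with h | h
  · exact (PP_lt_one hβ1 h).le
  · exact h.le

lemma pt_PP (hβ1 : 1 < β) (j : ℕ) (hj : j + 1 < (Xn β n).card) : PP β n (pt β n j) := by
  rcases pt_mem (β := β) (n := n) j (by omega) with h | h
  · exact h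
  · have h1 := pt_lt (Nat.lt_succ_self j) hj
    have h2 := pt_le_one hβ1 _ hj
    rw [h] at h1
    exact absurd h2 (not_le.2 h1)

lemma pt_index (hβ1 : 1 < β) (x : ℝ) (hx : PP β n x) :
    ∃ j, j + 1 < (Xn β n).card ∧ pt β n j = x := by
  obtain ⟨j, hj, rfl⟩ := pt_surj x (Or.inl hx)
  obtain ⟨l, hl, h1⟩ := pt_surj (β := β) (n := n) 1 (Or.inr rfl)
  refine ⟨j, ?_, rfl⟩
  have := lt_of_pt_lt (β := β) (n := n) (j := l) hj (by rw [h1]; exact PP_lt_one hβ1 hx)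
  omega

lemma PP_0 (hβ1 : 1 < β) : PP β n 0 := by
  induction n with
  | zero => rw [PP_zero]
  | succ n ih => rw [PP_succ β hβ1]; exact ⟨0, ih, Or.inl rfl⟩

lemma card_ge (hβ1 : 1 < β) : 2 ≤ (Xn β n).card := by
  obtain ⟨j, hj, _⟩ := pt_index (n := n) hβ1 0 (PP_0 hβ1)
  omega

lemma pt_zero (hβ1 : 1 < β) : pt β n 0 = 0 := by
  obtain ⟨j, hj, h⟩ := pt_index (n := n) hβ1 0 (PP_0 hβ1)
  have h1 := pt_le (Nat.zero_le j) (show j < (Xn β n).card by omega)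
  have h2 := (PP_range β hβ1 n _ (pt_PP hβ1 0 (by omega))).1
  linarith

lemma pt_last (hβ1 : 1 < β) : pt β n ((Xn β n).card - 1) = 1 := by
  have h2 := card_ge (n := n) hβ1
  obtain ⟨l, hl, h1⟩ := pt_surj (β := β) (n := n) 1 (Or.inr rfl)
  have h3 := pt_le (β := β) (n := n) (show l ≤ (Xn β n).card - 1 by omega) (show (Xn β n).card - 1 < _ by omega)
  have h4 := pt_le_one (n := n) hβ1 _ (show (Xn β n).card - 1 < _ by omega)
  linarith

lemma gap_inner (hβ1 : 1 < β) (hβ2 : β < 2) (j : ℕ) (hj : j + 2 < (Xn β n).card) :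
    pt β n (j+1) ≤ pt β n j + (β - 1) * (1 / β ^ n) := by
  have h1 := pt_PP (n := n) hβ1 j (by omega)
  have h2 := pt_PP hβ1 (j+1) hj
  have h3 := pt_lt (Nat.lt_succ_self j) (show j + 1 < (Xn β n).card by omega)
  have h4 := (PP_range β hβ1 n _ h2).2
  obtain ⟨y, hy, h5, h6⟩ := PP_next β hβ1 hβ2 n _ h1 (by intro h; simp only [Nat.succ_eq_add_one] at h3; linarith)
  obtain ⟨k, hk, rfl⟩ := pt_index hβ1 y hy
  have := lt_of_pt_lt (show j < (Xn β n).card by omega) h5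
  exact (pt_le this (by omega)).trans h6

lemma gap_last (hβ1 : 1 < β) (hβ2 : β < 2) (j : ℕ) (hj : j + 2 = (Xn β n).card) :
    pt β n (j+1) = pt β n j + 1 / β ^ n := by
  have h1 := pt_PP (n := n) hβ1 j (by omega)
  have h2 := pt_last (n := n) hβ1
  rw [show (Xn β n).card - 1 = j + 1 by omega] at h2
  by_cases hc : pt β n j = 1 - 1 / β ^ n
  · rw [h2, hc]; ring
  · obtain ⟨y, hy, h5, h6⟩ := PP_next β hβ1 hβ2 n _ h1 hc
    obtain ⟨k, hk, rfl⟩ := pt_index hβ1 y hy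
    have := lt_of_pt_lt (show j < (Xn β n).card by omega) h5
    omega

lemma gap_le (hβ1 : 1 < β) (hβ2 : β < 2) (j : ℕ) (hj : j + 1 < (Xn β n).card) :
    pt β n (j+1) ≤ pt β n j + 1 / β ^ n := by
  have hi : 0 < 1 / β ^ n := by positivity
  rcases Nat.lt_or_ge (j+2) (Xn β n).card with h | h
  · have := gap_inner hβ1 hβ2 j h
    nlinarith
  · exact (gap_last hβ1 hβ2 j (by omega)).le

lemma gap_ge (m : ℕ) (hm : 2 ≤ m) (hβ1 : 1 < β) (hβ2 : β < 2) (h : β ^ m * (2 - β) = 1)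
    (j : ℕ) (hj : j + 1 < (Xn β n).card) :
    pt β n j + (1 - 1 / β) * (1 / β ^ n) ≤ pt β n (j+1) := by
  have hi : 0 < 1 / β ^ n := by positivity
  have hb : 0 < 1 / β := by positivity
  rcases Nat.lt_or_ge (j+2) (Xn β n).card with h' | h'
  · have := PP_sep m hm β hβ1 hβ2 h n _ _ (pt_PP hβ1 j hj) (pt_PP hβ1 (j+1) h')
      (pt_lt (Nat.lt_succ_self j) hj)
    linarith
  · rw [gap_last hβ1 hβ2 j (by omega)]
    nlinarith

lemma gap_many (m : ℕ) (hm : 2 ≤ m) (hβ1 : 1 < β) (hβ2 : β < 2) (h : β ^ m * (2 - β) = 1)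
    (j t : ℕ) (hj : j + t < (Xn β n).card) :
    pt β n j + t * ((1 - 1 / β) * (1 / β ^ n)) ≤ pt β n (j+t) := by
  induction t with
  | zero => simp
  | succ t ih =>
    have h1 := ih (by omega)
    have h2 := gap_ge m hm hβ1 hβ2 h (j+t) (by omega)
    push_cast
    rw [← add_assoc]
    linarith

lemma find_gap (hβ1 : 1 < β) (x : ℝ) (h0 : 0 ≤ x) (h1 : x ≤ 1) :
    ∃ i, i + 1 < (Xn β n).card ∧ pt β n i ≤ x ∧ x ≤ pt β n (i+1) := by
  classical
  have hK := card_ge (n := n) hβ1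
  set i := Nat.findGreatest (fun i => pt β n i ≤ x) ((Xn β n).card - 2) with hi
  have hi1 : i ≤ (Xn β n).card - 2 := Nat.findGreatest_le _
  have hi2 : pt β n i ≤ x := by
    have := Nat.findGreatest_spec (P := fun i => pt β n i ≤ x) (m := 0)
      (n := (Xn β n).card - 2) (Nat.zero_le _) (by rw [pt_zero hβ1]; exact h0)
    exact this
  refine ⟨i, by omega, hi2, ?_⟩
  rcases hi1.eq_or_lt with h | h
  · have := pt_last (n := n) hβ1
    rw [show (Xn β n).card - 1 = i + 1 by omega] at this
    linarith
  · have := Nat.findGreatest_is_greatest (P := fun i => pt β n i ≤ x)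
      (n := (Xn β n).card - 2) (k := i + 1) (by omega) (by omega)
    exact (not_le.1 this).le

end enum

section main
variable {β p1 p2 : ℝ} {μ : Measure ℝ} [IsProbabilityMeasure μ]

/-- mass of a closed interval strictly inside a gap -/
lemma mu_inside (m : ℕ) (hm : 2 ≤ m) (hβ1 : 1 < β) (hβ2 : β < 2) (h : β ^ m * (2 - β) = 1)
    (hp1 : 0 < p1) (hp2 : 0 < p2) (hs : μ (Set.Icc 0 1)ᶜ = 0)
    (hμ : μ = ENNReal.ofReal p1 • μ.map (Smap β 0) + ENNReal.ofReal p2 • μ.map (Smap β 1))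
    (n i : ℕ) (hi : i + 2 < (Xn β n).card) (u v : ℝ) (hu : pt β n (i+1) < u)
    (hv : v < pt β n (i+2)) :
    μ.real (Set.Icc u v) ≤ Wn β p1 p2 n (pt β n i) + Wn β p1 p2 n (pt β n (i+1)) := by
  have hne : pt β n i ≠ pt β n (i+1) := (pt_lt (Nat.lt_succ_self i) (by omega)).ne
  rw [← Finset.sum_pair hne]
  apply mu_upper hβ1 hp1 hp2 hs hμ
  intro x hx hxv hxu
  obtain ⟨k, hk, rfl⟩ := pt_index hβ1 x hx
  have hk2 : k < i + 2 := lt_of_pt_lt (β := β) (n := n) (by omega) (by linarith)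
  have hk3 : i ≤ k := by
    by_contra hc
    have h1 := PP_three m hm β hβ1 hβ2 h n _ _ _ (pt_PP hβ1 k hk) (pt_PP hβ1 i (by omega))
      (pt_PP hβ1 (i+1) (by omega)) (pt_lt (not_le.1 hc) (by omega))
      (pt_lt (Nat.lt_succ_self i) (by omega))
    linarith
  have : k = i ∨ k = i + 1 := by omega
  rcases this with rfl | rfl <;> simp

lemma ball_pow (D : ℝ) (hD : 0 ≤ D)
    (H : ∀ x r : ℝ, 0 ≤ x → x ≤ 1 → 0 < r → μ.real (Metric.closedBall x (2 * r)) ≤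
      D * μ.real (Metric.closedBall x r)) (x r : ℝ) (hx0 : 0 ≤ x) (hx1 : x ≤ 1) (hr : 0 < r) (k : ℕ) :
    μ.real (Metric.closedBall x (2 ^ k * r)) ≤ D ^ k * μ.real (Metric.closedBall x r) := by
  induction k with
  | zero => simp
  | succ k ih =>
    have h1 := H x (2 ^ k * r) hx0 hx1 (by positivity)
    have h2 := mul_le_mul_of_nonneg_left ih hD
    rw [pow_succ', pow_succ', mul_assoc, mul_assoc]
    linarith

lemma forward (m : ℕ) (hm : 2 ≤ m) (hβ1 : 1 < β) (hβ2 : β < 2) (h : β ^ m * (2 - β) = 1)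
    (hp1 : 0 < p1) (hp2 : 0 < p2) (hs : μ (Set.Icc 0 1)ᶜ = 0)
    (hμ : μ = ENNReal.ofReal p1 • μ.map (Smap β 0) + ENNReal.ofReal p2 • μ.map (Smap β 1))
    (D : ℝ) (hD : 0 ≤ D)
    (H : ∀ x r : ℝ, 0 ≤ x → x ≤ 1 → 0 < r → μ.real (Metric.closedBall x (2 * r)) ≤
      D * μ.real (Metric.closedBall x r)) :
    ∃ C : ℝ, 0 < C ∧ ∀ n j, j + 3 < (Xn β n).card →
      Wn β p1 p2 n (pt β n j) + Wn β p1 p2 n (pt β n (j+1)) ≤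
        C * (Wn β p1 p2 n (pt β n (j+1)) + Wn β p1 p2 n (pt β n (j+2))) ∧
      Wn β p1 p2 n (pt β n (j+1)) + Wn β p1 p2 n (pt β n (j+2)) ≤
        C * (Wn β p1 p2 n (pt β n j) + Wn β p1 p2 n (pt β n (j+1))) := by
  have hq : 0 < 1 - 1 / β := by
    have : 1 / β < 1 := by rw [div_lt_one (by linarith)]; exact hβ1
    linarith
  obtain ⟨k, hk⟩ := pow_unbounded_of_one_lt (16 / (1 - 1 / β)) (show (1:ℝ) < 2 by norm_num)
  rw [div_lt_iff₀ hq] at hk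
  -- key estimate
  have key : ∀ n i : ℕ, i + 2 < (Xn β n).card → ∀ x : ℝ, |x - pt β n (i+1)| ≤ 2 * (1 / β ^ n) →
      Wn β p1 p2 n x ≤ D ^ k *
        (Wn β p1 p2 n (pt β n i) + Wn β p1 p2 n (pt β n (i+1))) := by
    intro n i hi x hx
    set hh : ℝ := 1 / β ^ n with hhh
    have hh0 : 0 < hh := by positivity
    set c := (pt β n (i+1) + pt β n (i+2)) / 2 with hc
    set ρ := (1 - 1 / β) * hh / 4 with hρ
    have hρ0 : 0 < ρ := by positivity
    have g1 := gap_ge m hm hβ1 hβ2 h (i+1) hi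
    have g2 := gap_le hβ1 hβ2 (i+1) hi
    rw [← hhh] at g1 g2
    rw [show i + 1 + 1 = i + 2 from rfl] at g1 g2
    have r1 := (PP_range β hβ1 n _ (pt_PP hβ1 (i+1) hi)).1
    have r2 := pt_le_one hβ1 (i+2) hi
    have hin : μ.real (Metric.closedBall c ρ) ≤
        Wn β p1 p2 n (pt β n i) + Wn β p1 p2 n (pt β n (i+1)) := by
      rw [Real.closedBall_eq_Icc]
      have hqq : 0 < (1 - 1 / β) * hh := by positivity
      apply mu_inside m hm hβ1 hβ2 h hp1 hp2 hs hμ n i hi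
      · rw [hc, hρ]; linarith
      · rw [hc, hρ]; linarith
    have hout : Wn β p1 p2 n x ≤ μ.real (Metric.closedBall c (2 ^ k * ρ)) := by
      apply W_le_mu hβ1 hp1 hp2 hs hμ n x _ Metric.isClosed_closedBall.measurableSet
      rw [Real.closedBall_eq_Icc, ← hhh]
      have hbig : 4 * hh ≤ 2 ^ k * ρ := by
        rw [hρ]; nlinarith
      have := abs_le.1 hx
      apply Set.Icc_subset_Icc
      · rw [hc]; linarith [this.1]
      · rw [hc]; linarith [this.2]
    have hb := ball_pow D hD H c ρ (by rw [hc]; linarith) (by rw [hc]; linarith) hρ0 k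
    calc _ ≤ _ := hout
      _ ≤ _ := hb
      _ ≤ _ := mul_le_mul_of_nonneg_left hin (by positivity)
  refine ⟨2 * D ^ k + 1, by positivity, fun n j hj => ?_⟩
  have hh0 : 0 < 1 / β ^ n := by positivity
  have g1 := gap_le (n := n) hβ1 hβ2 j (by omega)
  have g2 := gap_le (n := n) hβ1 hβ2 (j+1) (by omega)
  have l1 := pt_lt (β := β) (n := n) (show j < j + 1 by omega) (by omega)
  have l2 := pt_lt (β := β) (n := n) (show j + 1 < j + 2 by omega) (by omega)
  rw [show j + 1 + 1 = j + 2 from rfl] at g2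
  have w0 := Wn_nonneg (β := β) hp1 hp2 n (pt β n j)
  have w1 := Wn_nonneg (β := β) hp1 hp2 n (pt β n (j+1))
  have w2 := Wn_nonneg (β := β) hp1 hp2 n (pt β n (j+2))
  constructor
  · have a := key n (j+1) (by omega) (pt β n j) (by
      rw [abs_le]; constructor <;> linarith)
    have b := key n (j+1) (by omega) (pt β n (j+1)) (by
      rw [abs_le]; constructor <;> linarith)
    rw [show j + 1 + 1 = j + 2 from rfl] at a b
    linarith
  · have a := key n j (by omega) (pt β n (j+1)) (by
      rw [abs_le]; constructor <;> linarith)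
    have b := key n j (by omega) (pt β n (j+2)) (by
      rw [abs_le]; constructor <;> linarith)
    linarith

/-- weight of a gap -/
def VV (β p1 p2 : ℝ) (n i : ℕ) : ℝ :=
  Wn β p1 p2 n (pt β n i) + if i = 0 then 0 else Wn β p1 p2 n (pt β n (i-1))

lemma VV_succ (n i : ℕ) : VV β p1 p2 n (i+1) =
    Wn β p1 p2 n (pt β n i) + Wn β p1 p2 n (pt β n (i+1)) := by
  simp [VV, add_comm]

lemma W_le_VV (hp1 : 0 < p1) (hp2 : 0 < p2) (n i : ℕ) :
    Wn β p1 p2 n (pt β n i) ≤ VV β p1 p2 n i := by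
  unfold VV
  split_ifs
  · simp
  · have := Wn_nonneg (β := β) hp1 hp2 n (pt β n (i-1)); linarith

lemma VV_nonneg (hp1 : 0 < p1) (hp2 : 0 < p2) (n i : ℕ) : 0 ≤ VV β p1 p2 n i :=
  (Wn_nonneg hp1 hp2 n _).trans (W_le_VV hp1 hp2 n i)

lemma VV_lower (m : ℕ) (hm : 2 ≤ m) (hβ1 : 1 < β) (hβ2 : β < 2) (h : β ^ m * (2 - β) = 1)
    (hp1 : 0 < p1) (hp2 : 0 < p2) (hs : μ (Set.Icc 0 1)ᶜ = 0)
    (hμ : μ = ENNReal.ofReal p1 • μ.map (Smap β 0) + ENNReal.ofReal p2 • μ.map (Smap β 1)) :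
    ∃ c : ℝ, 0 < c ∧ ∀ n i, i + 1 < (Xn β n).card →
      c * VV β p1 p2 n i ≤ μ.real (Set.Icc (pt β n i) (pt β n (i+1))) := by
  have hq : 0 < 1 - 1 / β := by
    have : 1 / β < 1 := by rw [div_lt_one (by linarith)]; exact hβ1
    linarith
  set η := min ((1 - 1 / β) / 2) (2 - β) with hη
  have hη0 : 0 < η := lt_min (by linarith) (by linarith)
  have hη1 : η ≤ (1 - 1 / β) / 2 := min_le_left _ _
  have hη2 : η ≤ 2 - β := min_le_right _ _
  obtain ⟨c, hc, hc1, H⟩ := mu_sub (μ := μ) hβ1 hβ2 hp1 hp2 hs hμ η hη0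
  refine ⟨c / 2, by linarith, fun n i hi => ?_⟩
  have hh0 : 0 < 1 / β ^ n := by positivity
  have g1 := gap_ge m hm hβ1 hβ2 h i hi
  have g2 := gap_le hβ1 hβ2 i hi
  have e1 : 2 * (η * (1 / β ^ n)) ≤ (1 - 1 / β) * (1 / β ^ n) := by nlinarith
  have e2 : 0 < η * (1 / β ^ n) := by positivity
  have e3 : η * (1 / β ^ n) ≤ (2 - β) * (1 / β ^ n) := mul_le_mul_of_nonneg_right hη2 hh0.le
  have a := H n (pt β n i) (pt β n i + η * (1 / β ^ n)) (pt β n i) (pt β n (i+1))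
    (by linarith) (by linarith) (by linarith) (by linarith)
  have w := measureReal_nonneg (μ := μ) (s := Set.Icc (pt β n i) (pt β n (i+1)))
  rcases Nat.eq_zero_or_pos i with h0 | h0
  · subst h0
    simp only [VV, if_true, add_zero]
    linarith
  · obtain ⟨l, rfl⟩ : ∃ l, i = l + 1 := ⟨i - 1, by omega⟩
    have g3 := gap_inner (n := n) hβ1 hβ2 l hi
    have g4 := pt_lt (β := β) (n := n) (Nat.lt_succ_self l) (by omega)
    simp only [Nat.succ_eq_add_one] at g4
    have b := H n (pt β n l) (pt β n (l+1) + η * (1 / β ^ n)) (pt β n (l+1)) (pt β n (l+1+1))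
      (by linarith) (by linarith) (by linarith) (by linarith)
    rw [VV_succ]
    linarith

lemma chain (V : ℕ → ℝ) (N : ℕ) (M : ℝ) (hM : 1 ≤ M)
    (H : ∀ i, i + 1 < N → V i ≤ M * V (i+1) ∧ V (i+1) ≤ M * V i) (i t : ℕ) (hi : i + t < N) :
    V i ≤ M ^ t * V (i+t) ∧ V (i+t) ≤ M ^ t * V i := by
  induction t with
  | zero => simp
  | succ t ih =>
    obtain ⟨a, b⟩ := ih (by omega)
    obtain ⟨c, d⟩ := H (i+t) (by omega)
    have hp : 0 ≤ M ^ t := by positivity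
    rw [← add_assoc]
    constructor
    · have := mul_le_mul_of_nonneg_left c hp
      rw [pow_succ, mul_assoc]; linarith
    · have := mul_le_mul_of_nonneg_left b (show 0 ≤ M by linarith)
      rw [pow_succ', mul_assoc]; linarith

lemma chain' (V : ℕ → ℝ) (hV : ∀ i, 0 ≤ V i) (N : ℕ) (M : ℝ) (hM : 1 ≤ M)
    (H : ∀ i, i + 1 < N → V i ≤ M * V (i+1) ∧ V (i+1) ≤ M * V i) (L i k : ℕ) (hi : i < N)
    (hk : k < N) (h1 : k ≤ i + L) (h2 : i ≤ k + L) : V k ≤ M ^ L * V i := by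
  have hpow : ∀ t, t ≤ L → M ^ t * V i ≤ M ^ L * V i := fun t ht =>
    mul_le_mul_of_nonneg_right (pow_le_pow_right₀ hM ht) (hV i)
  rcases le_total i k with h | h
  · obtain ⟨t, rfl⟩ := Nat.exists_eq_add_of_le h
    exact (chain V N M hM H i t hk).2.trans (hpow t (by omega))
  · obtain ⟨t, rfl⟩ := Nat.exists_eq_add_of_le h
    exact (chain V N M hM H k t hi).1.trans (hpow t (by omega))

lemma backward (m : ℕ) (hm : 2 ≤ m) (hβ1 : 1 < β) (hβ2 : β < 2) (h : β ^ m * (2 - β) = 1)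
    (hp1 : 0 < p1) (hp2 : 0 < p2) (hp : p1 + p2 = 1) (hs : μ (Set.Icc 0 1)ᶜ = 0)
    (hμ : μ = ENNReal.ofReal p1 • μ.map (Smap β 0) + ENNReal.ofReal p2 • μ.map (Smap β 1))
    (C : ℝ)
    (H : ∀ n, 2 ≤ n → ∀ j, j + 3 < (Xn β n).card →
      Wn β p1 p2 n (pt β n j) + Wn β p1 p2 n (pt β n (j+1)) ≤
        C * (Wn β p1 p2 n (pt β n (j+1)) + Wn β p1 p2 n (pt β n (j+2))) ∧
      Wn β p1 p2 n (pt β n (j+1)) + Wn β p1 p2 n (pt β n (j+2)) ≤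
        C * (Wn β p1 p2 n (pt β n j) + Wn β p1 p2 n (pt β n (j+1)))) :
    ∃ D : ℝ, 0 ≤ D ∧ ∀ x r : ℝ, 0 ≤ x → x ≤ 1 → 0 < r → μ.real (Metric.closedBall x (2 * r)) ≤
      D * μ.real (Metric.closedBall x r) := by
  have hq : 0 < 1 - 1 / β := by
    have : 1 / β < 1 := by rw [div_lt_one (by linarith)]; exact hβ1
    linarith
  have hb0 : 0 < β := by linarith
  set M := max 1 (max C (2 / p1)) with hMdef
  have hM1 : 1 ≤ M := le_max_left _ _
  have hMC : C ≤ M := (le_max_left _ _).trans (le_max_right _ _)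
  have hMp : 2 / p1 ≤ M := (le_max_right _ _).trans (le_max_right _ _)
  have adj : ∀ n, 2 ≤ n → ∀ i, i + 1 < (Xn β n).card - 1 →
      VV β p1 p2 n i ≤ M * VV β p1 p2 n (i+1) ∧ VV β p1 p2 n (i+1) ≤ M * VV β p1 p2 n i := by
    intro n hn i hi
    have v0 := VV_nonneg (β := β) hp1 hp2 n i
    have v1 := VV_nonneg (β := β) hp1 hp2 n (i+1)
    rcases Nat.eq_zero_or_pos i with h0 | h0
    · subst h0
      have w1 := Wn_nonneg (β := β) hp1 hp2 n (pt β n 1)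
      have e0 : VV β p1 p2 n 0 = Wn β p1 p2 n (pt β n 0) := by simp [VV]
      constructor
      · have : VV β p1 p2 n 0 ≤ VV β p1 p2 n (0+1) := by
          rw [VV_succ, e0]; simpa using w1
        nlinarith
      · obtain ⟨l, rfl⟩ : ∃ l, n = l + 1 := ⟨n - 1, by omega⟩
        have hh0 : 0 < (β - 1) * (1 / β ^ (l+1)) := mul_pos (by linarith) (by positivity)
        have g := gap_inner (n := l+1) hβ1 hβ2 0 (by omega)
        have a := Wn_small_le hβ1 hp1 hp2 hp l (pt β (l+1) 0) (by rw [pt_zero hβ1]; exact hh0.le)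
        have b := Wn_small_le hβ1 hp1 hp2 hp l (pt β (l+1) (0+1)) (by
          rw [pt_zero hβ1] at g; linarith)
        have z := Wn_zero_ge (β := β) (l+1) hp1 hp2
        rw [VV_succ]
        rw [e0] at v0 ⊢
        have : 2 / p1 * Wn β p1 p2 (l+1) (pt β (l+1) 0) ≤ M * Wn β p1 p2 (l+1) (pt β (l+1) 0) :=
          mul_le_mul_of_nonneg_right hMp v0
        have z2 : 2 / p1 * p1 ^ (l+1) ≤ 2 / p1 * Wn β p1 p2 (l+1) (pt β (l+1) 0) := by
          rw [pt_zero hβ1]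
          exact mul_le_mul_of_nonneg_left z (by positivity)
        have z3 : 2 / p1 * p1 ^ (l+1) = 2 * p1 ^ l := by
          rw [pow_succ]; field_simp
        linarith
    · obtain ⟨l, rfl⟩ : ∃ l, i = l + 1 := ⟨i - 1, by omega⟩
      obtain ⟨a, b⟩ := H n hn l (by omega)
      rw [VV_succ] at v0
      rw [VV_succ] at v1
      rw [VV_succ, VV_succ]
      rw [show l + 1 + 1 = l + 2 from rfl] at *
      exact ⟨a.trans (mul_le_mul_of_nonneg_right hMC v1),
        b.trans (mul_le_mul_of_nonneg_right hMC v0)⟩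
  obtain ⟨c, hc, hlow⟩ := VV_lower (μ := μ) m hm hβ1 hβ2 h hp1 hp2 hs hμ
  obtain ⟨c0, hc0, hc01, hfull⟩ := full_supp (μ := μ) hβ1 hβ2 hp1 hp2 hs hμ (1 / β) (by positivity)
  obtain ⟨L, hL⟩ := exists_nat_gt (6 / (1 - 1 / β))
  rw [div_lt_iff₀ hq] at hL
  set E := (2 * L + 1 : ℝ) * M ^ L / c with hE
  have hE0 : 0 ≤ E := by positivity
  refine ⟨E + 1 / c0, by positivity, fun x r hx0 hx1 hr => ?_⟩
  have hnn := measureReal_nonneg (μ := μ) (s := Metric.closedBall x r)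
  rcases le_or_gt (1 / β) r with hbig | hsmall
  · have h1 : c0 ≤ μ.real (Metric.closedBall x r) := by
      rw [Real.closedBall_eq_Icc]
      exact hfull x _ _ hx0 hx1 (by linarith) (by linarith)
    have h2 : μ.real (Metric.closedBall x (2 * r)) ≤ 1 := measureReal_le_one
    have h3 : 1 ≤ 1 / c0 * μ.real (Metric.closedBall x r) := by
      rw [div_mul_eq_mul_div, one_mul, le_div_iff₀ hc0]; linarith
    nlinarith
  · -- choose the scale
    have hr1 : 1 ≤ 1 / r := by
      rw [le_div_iff₀ hr]
      have : 1 / β ≤ 1 := by linarith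
      linarith
    obtain ⟨l, hl1, hl2⟩ := exists_nat_pow_near hr1 hβ1
    have hl : 1 ≤ l := by
      by_contra hcon
      have : l = 0 := by omega
      subst this
      rw [zero_add, pow_one, div_lt_iff₀ hr] at hl2
      rw [lt_div_iff₀ hb0] at hsmall
      linarith
    set n := l + 1 with hn
    set hh : ℝ := 1 / β ^ n with hhh
    have hh0 : 0 < hh := by positivity
    have hr2 : hh ≤ r := by
      rw [hhh, div_le_iff₀ (by positivity)]
      rw [div_lt_iff₀ hr] at hl2; linarith
    have hr3 : r ≤ 2 * hh := by
      rw [le_div_iff₀ hr] at hl1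
      have e : β ^ l * r * (β * hh) ≤ 1 * (β * hh) := mul_le_mul_of_nonneg_right hl1 (by positivity)
      have e2 : β ^ l * r * (β * hh) = r := by
        rw [hhh, hn]; field_simp; ring
      nlinarith
    obtain ⟨i, hi, hxi, hxi'⟩ := find_gap (n := n) hβ1 x hx0 hx1
    have g := gap_le (n := n) hβ1 hβ2 i hi
    rw [← hhh] at g
    have hlower : c * VV β p1 p2 n i ≤ μ.real (Metric.closedBall x r) := by
      refine (hlow n i hi).trans (measureReal_mono ?_ (by finiteness))
      rw [Real.closedBall_eq_Icc]
      apply Set.Icc_subset_Icc <;> linarith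
    -- the upper bound
    set J := (Finset.Icc (i - L) (i + L)).filter (fun k => k + 1 < (Xn β n).card) with hJ
    have hupper : μ.real (Metric.closedBall x (2 * r)) ≤
        ∑ y ∈ J.image (pt β n), Wn β p1 p2 n y := by
      rw [Real.closedBall_eq_Icc]
      apply mu_upper hβ1 hp1 hp2 hs hμ
      intro y hy hyv hyu
      rw [← hhh] at hyu
      obtain ⟨k, hk, rfl⟩ := pt_index hβ1 y hy
      apply Finset.mem_image_of_mem
      rw [hJ, Finset.mem_filter, Finset.mem_Icc]
      have hfar : ∀ a t : ℕ, a + t < (Xn β n).card → L ≤ t → pt β n a + 6 * hh < pt β n (a+t) := by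
        intro a t hat hLt
        have g := gap_many m hm hβ1 hβ2 h a t hat
        rw [← hhh] at g
        have : (L:ℝ) ≤ t := by exact_mod_cast hLt
        have h1 : (L:ℝ) * ((1 - 1 / β) * hh) ≤ t * ((1 - 1 / β) * hh) :=
          mul_le_mul_of_nonneg_right this (by positivity)
        have h2 : 6 * hh < L * (1 - 1 / β) * hh := mul_lt_mul_of_pos_right hL hh0
        linarith
      refine ⟨⟨?_, ?_⟩, hk⟩
      · by_contra hcon
        have := hfar k (i - k) (by omega) (by omega)
        rw [show k + (i - k) = i by omega] at this
        linarith
      · by_contra hcon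
        have := hfar i (k - i) (by omega) (by omega)
        rw [show i + (k - i) = k by omega] at this
        linarith
    have hinj : Set.InjOn (pt β n) J := by
      intro a ha b hb hab
      rw [hJ, Finset.mem_coe, Finset.mem_filter] at ha hb
      rcases lt_trichotomy a b with h' | h' | h'
      · exact absurd hab (pt_lt h' (by omega)).ne
      · exact h'
      · exact absurd hab (pt_lt h' (by omega)).ne'
    rw [Finset.sum_image hinj] at hupper
    have hterm : ∀ k ∈ J, Wn β p1 p2 n (pt β n k) ≤ M ^ L * VV β p1 p2 n i := by
      intro k hk
      rw [hJ, Finset.mem_filter, Finset.mem_Icc] at hk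
      refine (W_le_VV hp1 hp2 n k).trans ?_
      exact chain' _ (VV_nonneg hp1 hp2 n) ((Xn β n).card - 1) M hM1 (adj n (by omega)) L i k
        (by omega) (by omega) (by omega) (by omega)
    have hsum := Finset.sum_le_card_nsmul J _ _ hterm
    rw [nsmul_eq_mul] at hsum
    have hcard : (J.card : ℝ) ≤ 2 * L + 1 := by
      have : J.card ≤ 2 * L + 1 := by
        refine (Finset.card_filter_le _ _).trans ?_
        rw [Nat.card_Icc]; omega
      exact_mod_cast this
    have hV := VV_nonneg (β := β) hp1 hp2 n i
    have h4 : (J.card : ℝ) * (M ^ L * VV β p1 p2 n i) ≤ (2 * L + 1) * (M ^ L * VV β p1 p2 n i) :=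
      mul_le_mul_of_nonneg_right hcard (by positivity)
    have h5 : (2 * L + 1 : ℝ) * (M ^ L * VV β p1 p2 n i) = E * (c * VV β p1 p2 n i) := by
      rw [hE]; field_simp
    have h6 := mul_le_mul_of_nonneg_left hlower hE0
    have h7 : 0 ≤ 1 / c0 * μ.real (Metric.closedBall x r) := by positivity
    linarith

lemma doubling_iff (hβ1 : 1 < β) (hβ2 : β < 2)
    (hp1 : 0 < p1) (hp2 : 0 < p2) (hs : μ (Set.Icc 0 1)ᶜ = 0)
    (hμ : μ = ENNReal.ofReal p1 • μ.map (Smap β 0) + ENNReal.ofReal p2 • μ.map (Smap β 1)) :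
    IsDoubling μ ↔ ∃ D : ℝ, 0 ≤ D ∧ ∀ x r : ℝ, 0 ≤ x → x ≤ 1 → 0 < r →
      μ.real (Metric.closedBall x (2 * r)) ≤ D * μ.real (Metric.closedBall x r) := by
  unfold IsDoubling
  constructor
  · intro hd
    set S := (⨆ (x : ℝ) (_ : x ∈ Set.Icc (0:ℝ) 1) (r : ℝ) (_ : 0 < r),
      μ (Metric.closedBall x (2 * r)) / μ (Metric.closedBall x r)) with hS
    refine ⟨S.toReal, ENNReal.toReal_nonneg, fun x r h0 h1 hr => ?_⟩
    have hle : μ (Metric.closedBall x (2 * r)) / μ (Metric.closedBall x r) ≤ S := by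
      rw [hS]
      exact le_iSup₂_of_le x ⟨h0, h1⟩ (le_iSup₂_of_le r hr le_rfl)
    obtain ⟨c, hc, _, hf⟩ := full_supp (μ := μ) hβ1 hβ2 hp1 hp2 hs hμ r hr
    have hpos : μ (Metric.closedBall x r) ≠ 0 := by
      intro hz
      have := hf x (x - r) (x + r) h0 h1 le_rfl le_rfl
      rw [← Real.closedBall_eq_Icc, Measure.real, hz] at this
      simp at this; linarith
    rw [ENNReal.div_le_iff hpos (measure_ne_top _ _)] at hle
    have := ENNReal.toReal_mono (ENNReal.mul_ne_top hd.ne (measure_ne_top _ _)) hle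
    rwa [ENNReal.toReal_mul] at this
  · rintro ⟨D, hD, H⟩
    refine lt_of_le_of_lt ?_ (ENNReal.ofReal_lt_top (r := D))
    refine iSup₂_le fun x hx => iSup₂_le fun r hr => ?_
    apply ENNReal.div_le_of_le_mul
    have := ENNReal.ofReal_le_ofReal (H x r hx.1 hx.2 hr)
    rwa [ENNReal.ofReal_mul hD, ofReal_measureReal, ofReal_measureReal] at this

end main

/-- `μ_p` is doubling iff the weight sums of adjacent triples are
uniformly comparable. -/
theorem stmt_9 (m : ℕ) (hm : 2 ≤ m) (β : ℝ) (hβ1 : 1 < β) (hβ2 : β < 2)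
    (hβ : β ^ m = ∑ j ∈ Finset.range m, β ^ j)
    (p1 p2 : ℝ) (hp1 : 0 < p1) (hp2 : 0 < p2) (hp : p1 + p2 = 1)
    (μ : Measure ℝ) [IsProbabilityMeasure μ]
    (hμ : μ = ENNReal.ofReal p1 • μ.map (Smap β 0) + ENNReal.ofReal p2 • μ.map (Smap β 1)) :
    IsDoubling μ ↔
      ∃ C₁ C₂ : ℝ, 0 < C₁ ∧ 0 < C₂ ∧ ∀ n, 2 ≤ n → ∀ j, j + 3 < (Xn β n).card →
        C₁ ≤ (Wn β p1 p2 n (pt β n j) + Wn β p1 p2 n (pt β n (j+1))) /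
              (Wn β p1 p2 n (pt β n (j+1)) + Wn β p1 p2 n (pt β n (j+2))) ∧
        (Wn β p1 p2 n (pt β n j) + Wn β p1 p2 n (pt β n (j+1))) /
          (Wn β p1 p2 n (pt β n (j+1)) + Wn β p1 p2 n (pt β n (j+2))) ≤ C₂ := by
  have h := multi_eq m β hβ
  have hs := mu_supp hβ1 hp1 hp2 hp hμ
  rw [doubling_iff hβ1 hβ2 hp1 hp2 hs hμ]
  have hpos : ∀ n j, j + 3 < (Xn β n).card →
      0 < Wn β p1 p2 n (pt β n j) + Wn β p1 p2 n (pt β n (j+1)) ∧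
      0 < Wn β p1 p2 n (pt β n (j+1)) + Wn β p1 p2 n (pt β n (j+2)) := by
    intro n j hj
    have a := Wn_pos hp1 hp2 n _ (pt_PP hβ1 j (by omega))
    have b := Wn_pos hp1 hp2 n _ (pt_PP hβ1 (j+1) (by omega))
    have c := Wn_pos hp1 hp2 n _ (pt_PP hβ1 (j+2) (by omega))
    exact ⟨by linarith, by linarith⟩
  constructor
  · rintro ⟨D, hD, H⟩
    obtain ⟨C, hC, HC⟩ := forward m hm hβ1 hβ2 h hp1 hp2 hs hμ D hD H
    refine ⟨1 / C, C, by positivity, hC, fun n _ j hj => ?_⟩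
    obtain ⟨a, b⟩ := HC n j hj
    obtain ⟨q1, q2⟩ := hpos n j hj
    rw [div_le_iff₀ q2, le_div_iff₀ q2, div_mul_eq_mul_div, one_mul, div_le_iff₀ hC]
    exact ⟨by linarith, a⟩
  · rintro ⟨C₁, C₂, hC1, hC2, H⟩
    refine backward m hm hβ1 hβ2 h hp1 hp2 hp hs hμ (max C₂ (1 / C₁)) fun n hn j hj => ?_
    obtain ⟨a, b⟩ := H n hn j hj
    obtain ⟨q1, q2⟩ := hpos n j hj
    rw [div_le_iff₀ q2] at b
    rw [le_div_iff₀ q2] at a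
    constructor
    · exact b.trans (mul_le_mul_of_nonneg_right (le_max_left _ _) q2.le)
    · refine le_trans ?_ (mul_le_mul_of_nonneg_right (le_max_right _ _) q1.le)
      rw [div_mul_eq_mul_div, one_mul, le_div_iff₀ hC1]
      linarith
end
end

section
/- Let m = 2 (so β is the golden ratio) and let p₁ = p₂ = 1/2. Then for every n ≥ 2 and every j with 0 ≤ j ≤ #X_n − 4, the weight triple is 2-balanced: 1/2 ≤ (W_n(a_{n,j}) + W_n(a_{n,j+1})) / (W_n(a_{n,j+1}) + W_n(a_{n,j+2})) ≤ 2. -/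
open MeasureTheory

noncomputable section

/-- Number of representations of `x` as `∑_{k<n} e_k β^k`, with `β = 1 + s`, `β⁻¹ = s`. -/
def rr (s : ℝ) : ℕ → ℝ → ℕ
  | 0, x => if x = 0 then 1 else 0
  | n+1, x => rr s n (s * x) + rr s n (s * (x - 1))

structure GapInv (s : ℝ) (r : ℝ → ℕ) : Prop where
  sep : ∀ x x', 0 < r x → 0 < r x' → x < x' → x + s ≤ x'
  nxt : ∀ x x', 0 < r x → 0 < r x' → x < x' → 0 < r (x + s) ∨ 0 < r (x + 1)

structure WInv (s : ℝ) (r : ℝ → ℕ) : Prop extends GapInv s r where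
  H : ∀ x, 0 < r x → 0 < r (x + s) → 0 < r (x + s + 1) ∧ 0 < r (x - 1)
  I1 : ∀ x, 0 < r x → 0 < r (x + 1) → r (x - s) = 0 → r (x + 1) ≤ 2 * r x
  I2 : ∀ x, 0 < r x → 0 < r (x + 1) → r (x + 1 + s) = 0 → r x ≤ 2 * r (x + 1)
  I3 : ∀ x, 0 < r x → 0 < r (x + s) → 0 < r (x + s + 1) →
    r x ≤ 2 * r (x + s + 1) ∧ r (x + s + 1) ≤ r (x + s) + 2 * r x
  I4 : ∀ x, 0 < r x → 0 < r (x + 1) → 0 < r (x + 1 + s) →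
    r (x + 1 + s) ≤ 2 * r x ∧ r x ≤ r (x + 1) + 2 * r (x + 1 + s)
  I5 : ∀ x, 0 < r x → 0 < r (x + 1) → 0 < r (x + 1 + 1) →
    r x ≤ r (x + 1) ∧ r (x + 1 + 1) ≤ r (x + 1)

/-- The refined dichotomy for differences. -/
theorem GapInv.sep2 {s : ℝ} {r : ℝ → ℕ} (h1 : 1/2 < s) (h : GapInv s r) (x x' : ℝ)
    (hx : 0 < r x) (hx' : 0 < r x') (hl : x < x') :
    (x' = x + s) ∨ x + 1 ≤ x' := by
  have a := h.sep x x' hx hx' hl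
  rcases h.nxt x x' hx hx' hl with hn | hn
  · rcases a.eq_or_lt with e | e
    · left; exact e.symm
    · right
      have := h.sep _ _ hn hx' e
      linarith
  · right
    by_contra hc
    push Not at hc
    have := h.sep _ _ hx' hn hc
    linarith

/-- One step of the recursion. -/
def stepR (s : ℝ) (r : ℝ → ℕ) (y : ℝ) : ℕ := r (s * y) + r (s * (y - 1))

theorem stepR_mem {s : ℝ} (hs : s * s = 1 - s) {r : ℝ → ℕ} {y : ℝ} (hy : 0 < stepR s r y) :
    ∃ u, 0 < r u ∧ (y = u + s * u ∨ y = u + s * u + 1) := by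
  unfold stepR at hy
  rcases Nat.eq_zero_or_pos (r (s * y)) with h | h
  · refine ⟨s * (y - 1), by omega, Or.inr ?_⟩
    linear_combination (-(y - 1)) * hs
  · exact ⟨s * y, h, Or.inl (by linear_combination (-y) * hs)⟩

/-- Values at `βu`. -/
theorem stepR0 {s : ℝ} (hs : s * s = 1 - s) (r : ℝ → ℕ) (u y : ℝ) (hy : y = u + s * u) :
    stepR s r y = r u + r (u - s) := by
  unfold stepR
  have e1 : s * y = u := by rw [hy]; linear_combination u * hs
  have e2 : s * (y - 1) = u - s := by rw [hy]; linear_combination u * hs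
  rw [e1, e2]

theorem stepR1 {s : ℝ} (hs : s * s = 1 - s) (r : ℝ → ℕ) (u y : ℝ) (hy : y = u + s * u + 1) :
    stepR s r y = r u + r (u + s) := by
  unfold stepR
  have e1 : s * y = u + s := by rw [hy]; linear_combination u * hs
  have e2 : s * (y - 1) = u := by rw [hy]; linear_combination u * hs
  rw [e1, e2, add_comm]

theorem GapInv.step {s : ℝ} (hs : s * s = 1 - s) (h1 : 1/2 < s) (h2 : s < 1) {r : ℝ → ℕ}
    (h : GapInv s r) : GapInv s (stepR s r) := by
  constructor
  · intro y y' hy hy' hl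
    obtain ⟨u, hu, e⟩ := stepR_mem hs hy
    obtain ⟨v, hv, e'⟩ := stepR_mem hs hy'
    have key : ∀ u v : ℝ, 0 < r u → 0 < r v → u + s * u < v + s * v →
        u + s * u + 1 ≤ v + s * v := by
      intro u v hu hv hl
      have huv : u < v := by nlinarith
      have := h.sep u v hu hv huv
      nlinarith
    rcases e with e | e <;> rcases e' with e' | e'
    · have := key u v hu hv (by linarith)
      linarith
    · rcases lt_or_ge v u with c | c
      · exfalso
        rcases h.sep2 h1 v u hv hu c with c | c
        · rw [c] at e; nlinarith
        · nlinarith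
      · nlinarith
    · have huv : u < v := by nlinarith
      rcases h.sep2 h1 u v hu hv huv with c | c
      · exfalso
        rw [c] at e'; nlinarith
      · nlinarith
    · have := key u v hu hv (by linarith)
      linarith
  · intro y y' hy hy' hl
    obtain ⟨u, hu, e⟩ := stepR_mem hs hy
    obtain ⟨v, hv, e'⟩ := stepR_mem hs hy'
    rcases e with e | e
    · right
      rw [stepR1 hs r u (y + 1) (by linarith)]
      omega
    · have huv : u < v := by
        rcases e' with e' | e' <;> nlinarith
      rcases h.nxt u v hu hv huv with c | c
      · right
        rw [stepR1 hs r (u + s) (y + 1) (by rw [e]; linear_combination (-1 : ℝ) * hs)]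
        omega
      · left
        rw [stepR0 hs r (u + 1) (y + s) (by rw [e]; ring)]
        omega

theorem GapInv.zero_of_lt {s : ℝ} {r : ℝ → ℕ} (h : GapInv s r) {x z : ℝ} (hx : 0 < r x)
    (h1 : x < z) (h2 : z < x + s) : r z = 0 := by
  by_contra hc
  have := h.sep x z hx (Nat.pos_of_ne_zero hc) h1
  linarith

theorem GapInv.zero_of_gt {s : ℝ} {r : ℝ → ℕ} (h : GapInv s r) {x z : ℝ} (hx : 0 < r x)
    (h1 : z < x) (h2 : x - s < z) : r z = 0 := by
  by_contra hc
  have := h.sep z x (Nat.pos_of_ne_zero hc) hx h1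
  linarith

theorem K1 {s : ℝ} (hs : s * s = 1 - s) (h1 : 1/2 < s) (h2 : s < 1) {r : ℝ → ℕ}
    (h : GapInv s r) (y : ℝ) (hy : 0 < stepR s r y) (hy' : 0 < stepR s r (y + s)) :
    ∃ u, y = u + s * u + 1 ∧ 0 < r u ∧ 0 < r (u + 1) ∧ stepR s r y = r u ∧
      stepR s r (y + s) = r (u + 1) := by
  obtain ⟨u, hu, e⟩ := stepR_mem hs hy
  rcases e with e | e
  · exfalso
    have a : 0 < stepR s r (y + 1) := by
      rw [stepR1 hs r u (y + 1) (by linarith)]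
      omega
    have := (h.step hs h1 h2).sep _ _ hy' a (by linarith)
    linarith
  · have e1 := stepR1 hs r u y e
    have e2 := stepR0 hs r (u + 1) (y + s) (by rw [e]; ring)
    have z : 0 < r (u + 1) := by
      rcases Nat.eq_zero_or_pos (r (u + 1)) with c | c
      · have z : r (u + 1 - s) = 0 := h.zero_of_lt hu (by linarith) (by linarith)
        omega
      · exact c
    refine ⟨u, e, hu, z, ?_, ?_⟩
    · rw [e1, h.zero_of_gt z (z := u + s) (by linarith) (by linarith)]; rfl
    · rw [e2, h.zero_of_lt hu (z := u + 1 - s) (by linarith) (by linarith)]; rfl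

theorem K2 {s : ℝ} (hs : s * s = 1 - s) (h1 : 1/2 < s) (h2 : s < 1) {r : ℝ → ℕ}
    (h : GapInv s r) (y : ℝ) (hy : 0 < stepR s r y) (hy' : 0 < stepR s r (y + 1)) :
    ∃ u, y = u + s * u ∧ 0 < r u ∧ stepR s r y = r u + r (u - s) ∧
      stepR s r (y + 1) = r u + r (u + s) := by
  have main : ∃ u, y = u + s * u ∧ 0 < r u := by
    obtain ⟨u, hu, e⟩ := stepR_mem hs hy
    rcases e with e | e
    · exact ⟨u, e, hu⟩
    · refine ⟨u + s, by rw [e]; linear_combination (-1 : ℝ) * hs, ?_⟩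
      rw [stepR0 hs r (u + s + s) (y + 1) (by rw [e]; linear_combination (-2 : ℝ) * hs)] at hy'
      rcases Nat.eq_zero_or_pos (r (u + s)) with c | c
      · exfalso
        have c' : 0 < r (u + s + s) := by
          have : u + s + s - s = u + s := by ring
          rw [this] at hy'
          omega
        rcases h.nxt u (u + s + s) hu c' (by linarith) with d | d
        · omega
        · have := h.sep _ _ d c' (by linarith)
          linarith
      · exact c
  obtain ⟨u, e, hu⟩ := main
  exact ⟨u, e, hu, stepR0 hs r u y e, stepR1 hs r u (y + 1) (by linarith)⟩

theorem WInv.step {s : ℝ} (hs : s * s = 1 - s) (h1 : 1/2 < s) (h2 : s < 1) {r : ℝ → ℕ}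
    (h : WInv s r) : WInv s (stepR s r) := by
  have g := h.toGapInv
  have g' := g.step hs h1 h2
  refine { toGapInv := g', H := ?_, I1 := ?_, I2 := ?_, I3 := ?_, I4 := ?_, I5 := ?_ }
  · intro y hy hy'
    obtain ⟨u, e, hu, hu1, -, -⟩ := K1 hs h1 h2 g y hy hy'
    constructor
    · rw [stepR1 hs r (u + 1) (y + s + 1) (by rw [e]; ring)]
      omega
    · rw [stepR0 hs r u (y - 1) (by rw [e]; ring)]
      omega
  · intro y hy hy' hz
    obtain ⟨u, e, hu, e1, e2⟩ := K2 hs h1 h2 g y hy hy'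
    rw [stepR1 hs r (u - 1) (y - s) (by rw [e]; ring)] at hz
    rcases Nat.eq_zero_or_pos (r (u + s)) with c | c
    · omega
    · have := (h.H u hu c).2
      omega
  · intro y hy hy' hz
    obtain ⟨u, e, hu, e1, e2⟩ := K2 hs h1 h2 g y hy hy'
    rw [stepR0 hs r (u + 1) (y + 1 + s) (by rw [e]; ring)] at hz
    rcases Nat.eq_zero_or_pos (r (u - s)) with c | c
    · omega
    · have := (h.H (u - s) c (by rwa [sub_add_cancel])).1
      rw [sub_add_cancel] at this
      omega
  · intro y hy hy' hy''
    obtain ⟨u, e, hu, hu1, e1, e2⟩ := K1 hs h1 h2 g y hy hy'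
    have e3 := stepR1 hs r (u + 1) (y + s + 1) (by rw [e]; ring)
    rcases Nat.eq_zero_or_pos (r (u + 1 + s)) with c | c
    · have := h.I2 u hu hu1 c
      omega
    · have := h.I4 u hu hu1 c
      omega
  · intro y hy hy' hy''
    obtain ⟨u, e, hu, hu1, e1, e2⟩ := K1 hs h1 h2 g (y + 1) hy' hy''
    have e3 := stepR0 hs r u y (by linarith)
    rcases Nat.eq_zero_or_pos (r (u - s)) with c | c
    · have := h.I1 u hu hu1 c
      omega
    · have := h.I3 (u - s) c (by rwa [sub_add_cancel]) (by rwa [sub_add_cancel])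
      rw [sub_add_cancel] at this
      omega
  · intro y hy hy' hy''
    obtain ⟨u, e, hu, e1, e2⟩ := K2 hs h1 h2 g y hy hy'
    obtain ⟨v, e', hv, e1', e2'⟩ := K2 hs h1 h2 g (y + 1) hy' hy''
    have hvu : v = u + s := by
      have : (1 + s) * v = (1 + s) * (u + s) := by
        rw [e] at e'; linear_combination -e' - hs
      exact mul_left_cancel₀ (by linarith) this
    subst hvu
    have z1 : r (u - s) = 0 := by
      by_contra c
      have := (h.H (u - s) (Nat.pos_of_ne_zero c) (by rwa [sub_add_cancel])).1
      rw [sub_add_cancel] at this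
      have := g.sep _ _ hv this (by linarith)
      linarith
    have z2 : r (u + s + s) = 0 := by
      by_contra c
      have := (h.H (u + s) hv (Nat.pos_of_ne_zero c)).2
      have := g.sep _ _ this hu (by linarith)
      linarith
    omega

theorem rr_inv {s : ℝ} (hs : s * s = 1 - s) (h1 : 1/2 < s) (h2 : s < 1) (n : ℕ) :
    WInv s (rr s n) := by
  induction n with
  | zero =>
    have z : ∀ x, 0 < rr s 0 x → x = 0 := by
      intro x hx
      by_contra c
      simp [rr, c] at hx
    refine { sep := ?_, nxt := ?_, H := ?_, I1 := ?_, I2 := ?_, I3 := ?_, I4 := ?_, I5 := ?_ }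
    · intro x x' hx hx' hl
      have := z _ hx; have := z _ hx'; exfalso; linarith
    · intro x x' hx hx' hl
      have := z _ hx; have := z _ hx'; exfalso; linarith
    all_goals
      intro x hx hx'
      have := z _ hx; have := z _ hx'; exfalso; linarith
  | succ n ih => exact ih.step hs h1 h2

/-- Recursion in the most significant digit. -/
theorem rr_msb {s : ℝ} (hs : s * s = 1 - s) (n : ℕ) (x : ℝ) :
    rr s (n+1) x = rr s n x + rr s n (x - (1 + s) ^ n) := by
  induction n generalizing x with
  | zero =>
    have hs0 : s ≠ 0 := by rintro rfl; norm_num at hs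
    simp [rr, hs0]
  | succ n ih =>
    have e : rr s (n + 1 + 1) x = rr s (n+1) (s * x) + rr s (n+1) (s * (x - 1)) := rfl
    have e1 : rr s (n + 1) x = rr s n (s * x) + rr s n (s * (x - 1)) := rfl
    have e2 : rr s (n + 1) (x - (1 + s) ^ (n+1)) = rr s n (s * (x - (1 + s) ^ (n+1)))
      + rr s n (s * (x - (1 + s) ^ (n+1) - 1)) := rfl
    have f1 : s * (x - (1 + s) ^ (n+1)) = s * x - (1 + s)^n := by
      rw [pow_succ]; linear_combination (-(1+s)^n) * hs
    have f2 : s * (x - (1 + s) ^ (n+1) - 1) = s * (x - 1) - (1 + s)^n := by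
      rw [pow_succ]; linear_combination (-(1+s)^n) * hs
    rw [e, ih, ih, e1, e2, f1, f2]
    omega

theorem rr_bound {s : ℝ} (hs : s * s = 1 - s) (h1 : 0 < s) (n : ℕ) (x : ℝ)
    (hx : 0 < rr s n x) : x < (1 + s) ^ (n + 1) := by
  have aux : x ≤ (1 + s) ^ (n + 1) - (1 + s) := by
    induction n generalizing x with
    | zero =>
      have : x = 0 := by
        by_contra c
        simp [rr, c] at hx
      simp [this]
    | succ n ih =>
      rw [rr_msb hs] at hx
      have p : 0 < (1 + s) ^ n := by positivity
      have e1 : (1 + s) ^ (n + 1) = (1 + s)^n * (1 + s) := pow_succ _ _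
      have e2 : (1 + s) ^ (n + 1 + 1) = (1 + s)^(n+1) + (1 + s)^n := by
        rw [pow_succ, pow_succ]; linear_combination (1+s)^n * hs
      rcases Nat.eq_zero_or_pos (rr s n x) with c | c
      · have := ih _ (show 0 < rr s n (x - (1 + s)^n) by omega)
        linarith
      · have := ih _ c
        linarith
  linarith

theorem Wn_succ (β p q : ℝ) (n : ℕ) (hβ : β ≠ 0) (x : ℝ) :
    Wn β p q (n+1) x = p * Wn β p q n (β * x) + q * Wn β p q n (β * x - (β - 1)) := by
  unfold Wn
  rw [← (Fin.consEquiv (fun _ : Fin (n+1) => Fin 2)).sum_comp, Fintype.sum_prod_type,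
    Fin.sum_univ_two, Finset.mul_sum, Finset.mul_sum]
  congr 1
  · refine Finset.sum_congr rfl fun I _ => ?_
    have : (Sapply β (Fin.cons (0 : Fin 2) I : Fin (n+1) → Fin 2) 0 = x) ↔
        Sapply β I 0 = β * x := by
      simp only [Sapply, Smap, Fin.cons_zero, Fin.cons_succ, if_true]
      rw [div_eq_iff hβ, mul_comm]
    simp only [Fin.consEquiv, Equiv.coe_fn_mk, this, Fin.prod_univ_succ, Fin.cons_zero,
      Fin.cons_succ, pw, if_true, mul_ite, mul_zero]
  · refine Finset.sum_congr rfl fun I _ => ?_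
    have : (Sapply β (Fin.cons (1 : Fin 2) I : Fin (n+1) → Fin 2) 0 = x) ↔
        Sapply β I 0 = β * x - (β - 1) := by
      simp only [Sapply, Smap, Fin.cons_zero, Fin.cons_succ, one_ne_zero, if_false]
      field_simp
      constructor <;> intro h <;> linarith
    simp only [Fin.consEquiv, Equiv.coe_fn_mk, this, Fin.prod_univ_succ, Fin.cons_zero,
      Fin.cons_succ, pw, if_true, mul_ite, mul_zero, one_ne_zero, if_false]

theorem Wn_eq_rr {s : ℝ} (hs : s * s = 1 - s) (h0 : 0 < s) (n : ℕ) (x : ℝ) :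
    Wn (1 + s) (1/2) (1/2) n x = (rr s n ((1 + s) ^ (n+1) * x) : ℝ) / 2 ^ n := by
  induction n generalizing x with
  | zero =>
    have : (1 + s) ≠ 0 := by positivity
    by_cases hx : x = 0
    · simp [Wn, Sapply, rr, hx]
    · have hx' : ¬ (0 = x) := fun h => hx h.symm
      simp [Wn, Sapply, rr, hx, this, hx']
  | succ n ih =>
    rw [Wn_succ _ _ _ _ (by positivity), ih, ih, rr_msb hs]
    have e1 : (1 + s) ^ (n + 1) * ((1 + s) * x) = (1 + s) ^ (n + 1 + 1) * x := by ring
    have e2 : (1 + s) ^ (n + 1) * ((1 + s) * x - (1 + s - 1)) =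
        (1 + s) ^ (n + 1 + 1) * x - (1 + s)^n := by
      rw [pow_succ, pow_succ]; linear_combination (-(1+s)^n) * hs
    rw [e1, e2]
    push_cast
    rw [pow_succ (2:ℝ) n]
    field_simp

theorem Wn_pos_iff (β : ℝ) (n : ℕ) (x : ℝ) :
    0 < Wn β (1/2) (1/2) n x ↔ ∃ I : Fin n → Fin 2, Sapply β I 0 = x := by
  have pp : ∀ I : Fin n → Fin 2, 0 < ∏ k, pw (1/2) (1/2) (I k) := by
    intro I
    refine Finset.prod_pos fun k _ => ?_
    unfold pw; split_ifs <;> norm_num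
  unfold Wn
  rw [Finset.sum_pos_iff_of_nonneg]
  · constructor
    · rintro ⟨I, -, h⟩
      refine ⟨I, ?_⟩
      by_contra c
      simp [c] at h
    · rintro ⟨I, h⟩
      exact ⟨I, Finset.mem_univ _, by rw [if_pos h]; exact pp I⟩
  · intro I _
    split_ifs
    · exact (pp I).le
    · exact le_rfl

theorem mem_Xn_iff {s : ℝ} (hs : s * s = 1 - s) (h0 : 0 < s) (n : ℕ) (x : ℝ) :
    x ∈ Xn (1 + s) n ↔ 0 < rr s n ((1 + s) ^ (n+1) * x) ∨ x = 1 := by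
  unfold Xn
  have := Wn_pos_iff (1 + s) n x
  rw [Wn_eq_rr hs h0] at this
  have p : (0:ℝ) < 2 ^ n := by positivity
  rw [div_pos_iff_of_pos_right p, Nat.cast_pos] at this
  simp [this, or_comm]

theorem pt_facts (β : ℝ) (n : ℕ) :
    (∀ i, i < (Xn β n).card → pt β n i ∈ Xn β n) ∧
    (∀ i k, i < k → k < (Xn β n).card → pt β n i < pt β n k) ∧
    (∀ i z, i + 1 < (Xn β n).card → z ∈ Xn β n → pt β n i < z → pt β n (i+1) ≤ z) := by
  have len : ((Xn β n).sort (· ≤ ·)).length = (Xn β n).card := Finset.length_sort _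
  have e : ∀ i (h : i < (Xn β n).card), pt β n i = ((Xn β n).sort (· ≤ ·))[i]'(by omega) := by
    intro i h
    unfold pt
    exact List.getD_eq_getElem _ _ _
  have mono : ∀ i k, i < k → k < (Xn β n).card → pt β n i < pt β n k := by
    intro i k hik hk
    rw [e i (by omega), e k hk]
    exact (List.pairwise_iff_getElem.1 (Finset.sortedLT_sort (Xn β n)).pairwise) i k _ _ hik
  refine ⟨?_, mono, ?_⟩
  · intro i h
    rw [e i h, ← Finset.mem_sort (· ≤ ·)]
    exact List.getElem_mem _
  · intro i z hi hz hlt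
    rw [← Finset.mem_sort (· ≤ ·)] at hz
    obtain ⟨k, hk, rfl⟩ := List.getElem_of_mem hz
    rw [← e k (by omega)] at hlt ⊢
    have : i < k := by
      by_contra c
      rcases (not_lt.1 c).eq_or_lt with d | d
      · subst d; exact lt_irrefl _ hlt
      · exact lt_asymm hlt (mono _ _ d (by omega))
    rcases (Nat.succ_le_of_lt this).eq_or_lt with d | d
    · subst d; exact le_rfl
    · exact (mono _ _ d (by omega)).le

/-- Consecutive elements differ by `s` or `1`. -/
theorem GapInv.consec {s : ℝ} {r : ℝ → ℕ} (h1 : 1/2 < s) (h : GapInv s r) (a b : ℝ)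
    (ha : 0 < r a) (hb : 0 < r b) (hab : a < b) (hc : ∀ z, 0 < r z → a < z → b ≤ z) :
    b = a + s ∨ b = a + 1 := by
  rcases h.sep2 h1 a b ha hb hab with d | d
  · exact Or.inl d
  · rcases h.nxt a b ha hb hab with f | f
    · left
      exact le_antisymm (hc _ f (by linarith)) (h.sep a b ha hb hab)
    · right
      exact le_antisymm (hc _ f (by linarith)) d

theorem WInv.triple {s : ℝ} {r : ℝ → ℕ} (h1 : 1/2 < s) (h2 : s < 1) (h : WInv s r) (a b c : ℝ)
    (ha : 0 < r a) (hb : 0 < r b) (hc : 0 < r c)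
    (hab : b = a + s ∨ b = a + 1) (hbc : c = b + s ∨ c = b + 1) :
    r a ≤ r b + 2 * r c ∧ r c ≤ r b + 2 * r a := by
  rcases hab with rfl | rfl <;> rcases hbc with rfl | rfl
  · exfalso
    have := (h.H a ha hb).1
    have := h.sep _ _ hc this (by linarith)
    linarith
  · have := h.I3 a ha hb hc
    omega
  · have := h.I4 a ha hb hc
    omega
  · have := h.I5 a ha hb hc
    omega

/-- for `m = 2` (golden ratio) and `p₁ = p₂ = 1/2`, every weight triple
is 2-balanced. -/
theorem stmt_19 (β : ℝ) (hβ1 : 1 < β) (hβ2 : β < 2)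
    (hβ : β ^ 2 = ∑ j ∈ Finset.range 2, β ^ j)
    (n : ℕ) (hn : 2 ≤ n) (j : ℕ) (hj : j + 3 < (Xn β n).card) :
    1/2 ≤ (Wn β (1/2) (1/2) n (pt β n j) + Wn β (1/2) (1/2) n (pt β n (j+1))) /
            (Wn β (1/2) (1/2) n (pt β n (j+1)) + Wn β (1/2) (1/2) n (pt β n (j+2))) ∧
    (Wn β (1/2) (1/2) n (pt β n j) + Wn β (1/2) (1/2) n (pt β n (j+1))) /
      (Wn β (1/2) (1/2) n (pt β n (j+1)) + Wn β (1/2) (1/2) n (pt β n (j+2))) ≤ 2 := by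
  obtain ⟨s, rfl⟩ : ∃ s, β = 1 + s := ⟨β - 1, by ring⟩
  have hs : s * s = 1 - s := by
    simp [Finset.sum_range_succ] at hβ
    linarith
  have h0 : 0 < s := by linarith
  have h2 : s < 1 := by linarith
  have h1 : 1/2 < s := by nlinarith
  have inv := rr_inv hs h1 h2 n
  obtain ⟨hm, hmono, hcons⟩ := pt_facts (1 + s) n
  have hP : 0 < (1 + s) ^ (n + 1) := by positivity
  have hle : ∀ z ∈ Xn (1 + s) n, z ≤ 1 := by
    intro z hz
    rcases (mem_Xn_iff hs h0 n z).1 hz with c | c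
    · have := rr_bound hs h0 n _ c
      by_contra d
      push Not at d
      nlinarith
    · exact c.le
  have hr : ∀ i, i < j + 3 → 0 < rr s n ((1 + s) ^ (n + 1) * pt (1 + s) n i) := by
    intro i hi
    rcases (mem_Xn_iff hs h0 n _).1 (hm i (by omega)) with c | c
    · exact c
    · exfalso
      have a := hmono i (j + 3) hi hj
      have b := hle _ (hm (j + 3) hj)
      linarith
  have hgap : ∀ i, i + 1 < j + 3 →
      (1 + s) ^ (n + 1) * pt (1 + s) n (i+1) = (1 + s) ^ (n + 1) * pt (1 + s) n i + s ∨
      (1 + s) ^ (n + 1) * pt (1 + s) n (i+1) = (1 + s) ^ (n + 1) * pt (1 + s) n i + 1 := by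
    intro i hi
    refine inv.toGapInv.consec h1 _ _ (hr i (by omega)) (hr (i+1) hi) ?_ ?_
    · exact mul_lt_mul_of_pos_left (hmono i (i+1) (by omega) (by omega)) hP
    · intro z hz hlt
      have ez : z = (1 + s) ^ (n + 1) * (z / (1 + s) ^ (n + 1)) := by field_simp
      rw [ez] at hz hlt ⊢
      exact mul_le_mul_of_nonneg_left (hcons i _ (by omega) ((mem_Xn_iff hs h0 n _).2 (Or.inl hz))
        (lt_of_mul_lt_mul_left hlt hP.le)) hP.le
  have key := inv.triple h1 h2 _ _ _ (hr j (by omega)) (hr (j+1) (by omega)) (hr (j+2) (by omega))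
    (hgap j (by omega)) (hgap (j+1) (by omega))
  have pb := hr (j+1) (by omega)
  rw [Wn_eq_rr hs h0, Wn_eq_rr hs h0, Wn_eq_rr hs h0]
  generalize rr s n ((1 + s) ^ (n + 1) * pt (1 + s) n j) = A at *
  generalize rr s n ((1 + s) ^ (n + 1) * pt (1 + s) n (j+1)) = B at *
  generalize rr s n ((1 + s) ^ (n + 1) * pt (1 + s) n (j+2)) = C at *
  have k1 : (A : ℝ) ≤ B + 2 * C := by exact_mod_cast key.1
  have k2 : (C : ℝ) ≤ B + 2 * A := by exact_mod_cast key.2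
  have k3 : (0 : ℝ) < B := by exact_mod_cast pb
  have k4 : (0 : ℝ) ≤ C := Nat.cast_nonneg _
  have p2 : (0 : ℝ) < 2 ^ n := by positivity
  have e : ((A : ℝ) / 2 ^ n + B / 2 ^ n) / (B / 2 ^ n + C / 2 ^ n) = (A + B) / (B + C) := by
    rw [← add_div, ← add_div, div_div_div_cancel_right₀ p2.ne']
  rw [e]
  have q : (0 : ℝ) < B + C := by linarith
  constructor
  · rw [le_div_iff₀ q]; linarith
  · rw [div_le_iff₀ q]; linarith
end
end
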